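/- arXiv:1603.01799 — 3 statements merged into one kernel-verified Lean document; each statement's English description precedes it below -/
import Mathlib

section
/- For every half-space A ⊆ ℝ^n and every t > 0, E[ (1_A − P_t 1_A)² ] ≤ (1/π) arccos(e^{−t}). -/
open MeasureTheory Real

noncomputable def gauss (n : ℕ) : Measure (Fin n → ℝ) :=
  Measure.pi fun _ => ProbabilityTheory.gaussianReal 0 1

/-- Expectation with respect to the standard Gaussian measure on `ℝ^n`. -/
noncomputable def gExp (n : ℕ) (f : (Fin n → ℝ) → ℝ) : ℝ := ∫ x, f x ∂(gauss n)

/-- Covariance with respect to the standard Gaussian measure on `ℝ^n`. -/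
noncomputable def gCov (n : ℕ) (f g : (Fin n → ℝ) → ℝ) : ℝ :=
  gExp n (fun x => (f x - gExp n f) * (g x - gExp n g))

/-- Variance with respect to the standard Gaussian measure on `ℝ^n`. -/
noncomputable def gVar (n : ℕ) (f : (Fin n → ℝ) → ℝ) : ℝ := gCov n f f

/-- A half-space `{x : ⟨x, a⟩ ≤ b}` in `ℝ^n`. -/
def IsHalfspace {n : ℕ} (A : Set (Fin n → ℝ)) : Prop :=
  ∃ (a : Fin n → ℝ) (b : ℝ), A = {x | ∑ i, x i * a i ≤ b}

/-- The Ornstein--Uhlenbeck semigroup `P_t`. -/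
noncomputable def ou (n : ℕ) (t : ℝ) (f : (Fin n → ℝ) → ℝ) : (Fin n → ℝ) → ℝ :=
  fun x => ∫ y, f (fun i => Real.exp (-t) * x i + Real.sqrt (1 - Real.exp (-2*t)) * y i)
    ∂(gauss n)

/-- The shifted/rescaled function `f_{t,y}(x) = f(√(1-e^{-2t}) x + e^{-t} y)`. -/
noncomputable def shift (n : ℕ) (f : (Fin n → ℝ) → ℝ) (t : ℝ) (y : Fin n → ℝ) :
    (Fin n → ℝ) → ℝ :=
  fun x => f (fun i => Real.sqrt (1 - Real.exp (-2*t)) * x i + Real.exp (-t) * y i)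

/-- `M(g)`: the supremum over half-spaces `A` of `Cov(g, 1_A)`. -/
noncomputable def Mg (n : ℕ) (g : (Fin n → ℝ) → ℝ) : ℝ :=
  ⨆ A : {A : Set (Fin n → ℝ) // IsHalfspace A}, gCov n g (Set.indicator A.1 1)

/-- `w₁(f) = Σ_i (E[X_i f(X)])²`. -/
noncomputable def w1g (n : ℕ) (f : (Fin n → ℝ) → ℝ) : ℝ :=
  ∑ i : Fin n, (gExp n (fun x => x i * f x)) ^ 2

lemma gauss_isGaussian (n : ℕ) : ProbabilityTheory.IsGaussian (gauss n) := by
  have h := ProbabilityTheory.map_pi_eq_stdGaussian (ι := Fin n)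
  have h2 : ProbabilityTheory.IsGaussian
      ((gauss n).map (EuclideanSpace.equiv (Fin n) ℝ).symm) := by
    have : (gauss n).map (EuclideanSpace.equiv (Fin n) ℝ).symm =
        ProbabilityTheory.stdGaussian (EuclideanSpace ℝ (Fin n)) := h
    rw [this]; infer_instance
  exact (ProbabilityTheory.isGaussian_map_equiv_iff _).1 h2

lemma gauss_mean (n : ℕ) (L : StrongDual ℝ (Fin n → ℝ)) : ∫ x, L x ∂(gauss n) = 0 := by
  have h := ProbabilityTheory.map_pi_eq_stdGaussian (ι := Fin n)
  have h3 : (gauss n).map (EuclideanSpace.equiv (Fin n) ℝ).symm =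
        ProbabilityTheory.stdGaussian (EuclideanSpace ℝ (Fin n)) := h
  have h2 := ProbabilityTheory.integral_strongDual_stdGaussian
    (L.comp ((EuclideanSpace.equiv (Fin n) ℝ) : EuclideanSpace ℝ (Fin n) →L[ℝ] (Fin n → ℝ)))
  rw [← h3, integral_map (by fun_prop) (by fun_prop)] at h2
  exact h2

lemma gauss_rot (n : ℕ) (φ : ℝ) :
    ((gauss n).prod (gauss n)).map (ContinuousLinearMap.rotation φ) =
      (gauss n).prod (gauss n) := by
  have := gauss_isGaussian n
  exact ProbabilityTheory.IsGaussian.map_rotation_eq_self_of_forall_strongDual_eq_zero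
    (gauss_mean n) φ

/-- indicator of a half line -/
noncomputable def hl (b s : ℝ) : ℝ := if s ≤ b then 1 else 0

lemma hl_meas (b : ℝ) : Measurable (hl b) :=
  Measurable.ite measurableSet_Iic measurable_const measurable_const

lemma hl_nonneg (b s : ℝ) : 0 ≤ hl b s := by unfold hl; split_ifs <;> norm_num
lemma hl_le_one (b s : ℝ) : hl b s ≤ 1 := by unfold hl; split_ifs <;> norm_num
lemma hl_anti (b : ℝ) {s s' : ℝ} (h : s ≤ s') : hl b s' ≤ hl b s := by
  unfold hl; split_ifs <;> first | (exfalso; linarith) | norm_num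

lemma ii_bdd {f : ℝ → ℝ} (hf : Measurable f) (h : ∀ x, |f x| ≤ 1) (p q : ℝ) :
    IntervalIntegrable f volume p q := by
  rw [intervalIntegrable_iff]
  exact Measure.integrableOn_of_bounded (M := 1) (by simp) hf.aestronglyMeasurable
    (Filter.Eventually.of_forall h)

lemma abs_le_one_of {x : ℝ} (h0 : 0 ≤ x) (h1 : x ≤ 1) : |x| ≤ 1 := by rwa [abs_of_nonneg h0]

lemma core_window {f : ℝ → ℝ} (hf : Measurable f) (h0 : ∀ x, 0 ≤ f x) (h1 : ∀ x, f x ≤ 1)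
    (p q δ : ℝ) (hδ : 0 ≤ δ) :
    ∫ x in p..q, (f (x + δ) - f (x - δ)) ≤ 2 * δ := by
  have ii := fun p q => ii_bdd hf (fun x => abs_le_one_of (h0 x) (h1 x)) p q
  have i1 : IntervalIntegrable (fun x => f (x + δ)) volume p q :=
    ii_bdd (hf.comp (measurable_id.add_const δ))
      (fun x => abs_le_one_of (h0 (x + δ)) (h1 (x + δ))) p q
  have i2 : IntervalIntegrable (fun x => f (x - δ)) volume p q :=
    ii_bdd (hf.comp (measurable_id.sub_const δ))
      (fun x => abs_le_one_of (h0 (x - δ)) (h1 (x - δ))) p q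
  rw [intervalIntegral.integral_sub i1 i2,
    intervalIntegral.integral_comp_add_right, intervalIntegral.integral_comp_sub_right]
  have e1 := intervalIntegral.integral_add_adjacent_intervals
    (ii (p - δ) (p + δ)) (ii (p + δ) (q + δ))
  have e2 := intervalIntegral.integral_add_adjacent_intervals
    (ii (p - δ) (q - δ)) (ii (q - δ) (q + δ))
  have e3 : 0 ≤ ∫ x in (p - δ)..(p + δ), f x :=
    intervalIntegral.integral_nonneg (by linarith) (fun x _ => h0 x)
  have e4 : ∫ x in (q - δ)..(q + δ), f x ≤ ∫ x in (q - δ)..(q + δ), (1 : ℝ) :=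
    intervalIntegral.integral_mono_on (by linarith) (ii _ _) (by simp) (fun x _ => h1 x)
  simp at e4
  linarith

lemma core_circle (r b δ : ℝ) (hr : 0 ≤ r) (hδ : 0 ≤ δ) (hδ' : δ ≤ π) :
    ∫ x in (0)..(2 * π), |hl b (r * cos (x - δ)) - hl b (r * cos (x + δ))| ≤ 4 * δ := by
  set f : ℝ → ℝ := fun x => hl b (r * cos x) with hfd
  have hf : Measurable f := (hl_meas b).comp (by fun_prop)
  have h0 : ∀ x, 0 ≤ f x := fun x => hl_nonneg _ _
  have h1 : ∀ x, f x ≤ 1 := fun x => hl_le_one _ _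
  change ∫ x in (0)..(2 * π), |f (x - δ) - f (x + δ)| ≤ 4 * δ
  have hs : 0 ≤ sin δ := sin_nonneg_of_nonneg_of_le_pi hδ hδ'
  have hk : Measurable (fun x => |f (x - δ) - f (x + δ)|) :=
    ((hf.comp (measurable_id.sub_const δ)).sub (hf.comp (measurable_id.add_const δ))).abs
  have hk1 : ∀ x, |(|f (x - δ) - f (x + δ)|)| ≤ 1 := fun x => by
    rw [abs_abs, abs_le]
    constructor <;> linarith [h0 (x - δ), h0 (x + δ), h1 (x - δ), h1 (x + δ)]
  rw [← intervalIntegral.integral_add_adjacent_intervals (ii_bdd hk hk1 0 π)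
    (ii_bdd hk hk1 π (2 * π))]
  have a1 : ∫ x in (0)..π, |f (x - δ) - f (x + δ)| = ∫ x in (0)..π, (f (x + δ) - f (x - δ)) := by
    apply intervalIntegral.integral_congr
    intro x hx
    rw [Set.uIcc_of_le pi_pos.le] at hx
    have : 0 ≤ sin x := sin_nonneg_of_nonneg_of_le_pi hx.1 hx.2
    have h : f (x - δ) ≤ f (x + δ) := by
      apply hl_anti
      apply mul_le_mul_of_nonneg_left _ hr
      rw [cos_add, cos_sub]
      nlinarith [mul_nonneg this hs]
    simp only
    rw [abs_of_nonpos (by linarith)]; ring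
  have a2 : ∫ x in π..(2 * π), |f (x - δ) - f (x + δ)| =
      ∫ x in π..(2 * π), ((fun y => 1 - f y) (x + δ) - (fun y => 1 - f y) (x - δ)) := by
    apply intervalIntegral.integral_congr
    intro x hx
    rw [Set.uIcc_of_le (by linarith [pi_pos])] at hx
    have : 0 ≤ sin (x - π) := sin_nonneg_of_nonneg_of_le_pi (by linarith [hx.1]) (by linarith [hx.2])
    rw [sin_sub_pi] at this
    have h : f (x + δ) ≤ f (x - δ) := by
      apply hl_anti
      apply mul_le_mul_of_nonneg_left _ hr
      rw [cos_add, cos_sub]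
      nlinarith [mul_nonneg this hs]
    simp only
    rw [abs_of_nonneg (by linarith)]; ring
  have b1 := core_window hf h0 h1 0 π δ hδ
  have b2 := core_window (f := fun y => 1 - f y) (measurable_const.sub hf)
    (fun x => by linarith [h1 x]) (fun x => by linarith [h0 x]) π (2 * π) δ hδ
  rw [a1, a2]; linarith

lemma core (u v b θ : ℝ) (hθ : 0 ≤ θ) (hθ' : θ ≤ π) :
    ∫ x in (0)..(2 * π), |hl b (u * cos x + v * sin x)
      - hl b (u * cos (x + θ) + v * sin (x + θ))| ≤ 2 * θ := by
  set z : ℂ := ⟨u, v⟩ with hz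
  have hu : u = ‖z‖ * cos z.arg := by rw [Complex.norm_mul_cos_arg]
  have hv : v = ‖z‖ * sin z.arg := by rw [Complex.norm_mul_sin_arg]
  have key := core_circle ‖z‖ b (θ / 2) (norm_nonneg _) (by linarith) (by linarith)
  set k : ℝ → ℝ := fun x => |hl b (‖z‖ * cos (x - θ / 2)) - hl b (‖z‖ * cos (x + θ / 2))| with hk
  have per : Function.Periodic k (2 * π) := by
    intro x
    simp only [hk]
    rw [show x + 2 * π - θ / 2 = (x - θ / 2) + 2 * π by ring,
      show x + 2 * π + θ / 2 = (x + θ / 2) + 2 * π by ring, cos_add_two_pi, cos_add_two_pi]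
  have e : ∀ x, |hl b (u * cos x + v * sin x) - hl b (u * cos (x + θ) + v * sin (x + θ))|
      = k (x + (θ / 2 - z.arg)) := by
    intro x
    simp only [hk]
    have e1 : ∀ y, u * cos y + v * sin y = ‖z‖ * cos (y - z.arg) := by
      intro y
      rw [cos_sub]
      nth_rewrite 1 [hu]
      nth_rewrite 1 [hv]
      ring
    rw [e1, e1]
    congr 5 <;> ring
  simp_rw [e]
  rw [intervalIntegral.integral_comp_add_right]
  have := per.intervalIntegral_add_eq (0 + (θ / 2 - z.arg)) 0
  rw [zero_add (2 * π)] at this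
  rw [show 2 * π + (θ / 2 - z.arg) = 0 + (θ / 2 - z.arg) + 2 * π by ring, this]
  linarith

theorem stmt8 (n : ℕ) (A : Set (Fin n → ℝ)) (hA : IsHalfspace A) (t : ℝ)
    (ht : 0 < t) :
    gExp n (fun x => (Set.indicator A 1 x - ou n t (Set.indicator A 1) x) ^ 2) ≤
      (1 / Real.pi) * Real.arccos (Real.exp (-t)) := by
  obtain ⟨a, b, rfl⟩ := hA
  have := gauss_isGaussian n
  set μ := gauss n with hμ
  set θ := arccos (exp (-t)) with hθ
  have hle : exp (-t) ≤ 1 := by rw [exp_le_one_iff]; linarith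
  have hc : cos θ = exp (-t) := cos_arccos (by linarith [exp_pos (-t)]) hle
  have hs : sin θ = √(1 - exp (-2 * t)) := by
    rw [hθ, sin_arccos, ← exp_nat_mul]; congr 3; push_cast; ring_nf
  set l : (Fin n → ℝ) → ℝ := fun x => ∑ i, x i * a i with hl_def
  have lm : Measurable l := by fun_prop
  have ladd : ∀ (c d : ℝ) (x y : Fin n → ℝ), l (c • x + d • y) = c * l x + d * l y := by
    intro c d x y
    simp only [hl_def, Pi.add_apply, Pi.smul_apply, smul_eq_mul, Finset.mul_sum,
      ← Finset.sum_add_distrib]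
    exact Finset.sum_congr rfl fun i _ => by ring
  have ind : ∀ x, Set.indicator {x : Fin n → ℝ | l x ≤ b} (1 : (Fin n → ℝ) → ℝ) x = hl b (l x) := by
    intro x
    simp [Set.indicator, hl]
  -- the joint function
  set G : (Fin n → ℝ) × (Fin n → ℝ) → ℝ := fun p =>
    |hl b (l p.1) - hl b (cos θ * l p.1 + sin θ * l p.2)| with hG
  have Gm : Measurable G :=
    (((hl_meas b).comp (by fun_prop)).sub ((hl_meas b).comp (by fun_prop))).abs
  have G0 : ∀ p, 0 ≤ G p := fun p => abs_nonneg _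
  have habs : ∀ s s', |hl b s - hl b s'| ≤ 1 := fun s s' => by
    rw [abs_le]
    constructor <;> linarith [hl_nonneg b s, hl_nonneg b s', hl_le_one b s, hl_le_one b s']
  have G1 : ∀ p, |G p| ≤ 1 := fun p => by rw [abs_of_nonneg (G0 p)]; exact habs _ _
  have Gi : Integrable G (μ.prod μ) :=
    Integrable.of_bound Gm.aestronglyMeasurable 1 (Filter.Eventually.of_forall G1)
  have ouE : ∀ x, ou n t (Set.indicator {x : Fin n → ℝ | l x ≤ b} 1) x
      = ∫ y, hl b (cos θ * l x + sin θ * l y) ∂μ := by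
    intro x
    unfold ou
    refine integral_congr_ae (Filter.Eventually.of_forall fun y => ?_)
    simp only
    rw [ind, ← ladd, hc, hs]
    rfl
  have step1 : ∀ x, (hl b (l x) - ∫ y, hl b (cos θ * l x + sin θ * l y) ∂μ) ^ 2 ≤
      ∫ y, G (x, y) ∂μ := by
    intro x
    have mm : Measurable fun y => hl b (cos θ * l x + sin θ * l y) :=
      (hl_meas b).comp (by fun_prop)
    have hi : Integrable (fun y => hl b (cos θ * l x + sin θ * l y)) μ :=
      Integrable.of_bound mm.aestronglyMeasurable 1 (Filter.Eventually.of_forall fun y =>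
        abs_le_one_of (hl_nonneg _ _) (hl_le_one _ _))
    have e : hl b (l x) - ∫ y, hl b (cos θ * l x + sin θ * l y) ∂μ =
        ∫ y, (hl b (l x) - hl b (cos θ * l x + sin θ * l y)) ∂μ := by
      rw [integral_sub (integrable_const _) hi]; simp
    have h1 : |∫ y, (hl b (l x) - hl b (cos θ * l x + sin θ * l y)) ∂μ| ≤ ∫ y, G (x, y) ∂μ :=
      abs_integral_le_integral_abs
    have h2 : ∫ y, G (x, y) ∂μ ≤ ∫ y, (1 : ℝ) ∂μ := by
      refine integral_mono_of_nonneg (Filter.Eventually.of_forall fun y => G0 _)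
        (integrable_const _) (Filter.Eventually.of_forall fun y => habs _ _)
    simp at h2
    rw [e, ← sq_abs]
    nlinarith [abs_nonneg (∫ y, (hl b (l x) - hl b (cos θ * l x + sin θ * l y)) ∂μ)]
  have step2 : gExp n (fun x => (Set.indicator {x : Fin n → ℝ | l x ≤ b} 1 x
      - ou n t (Set.indicator {x : Fin n → ℝ | l x ≤ b} 1) x) ^ 2) ≤ ∫ p, G p ∂(μ.prod μ) := by
    unfold gExp
    rw [integral_prod _ Gi]
    simp_rw [ind, ouE]
    exact integral_mono_of_nonneg (Filter.Eventually.of_forall fun x => sq_nonneg _)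
      Gi.integral_prod_left (Filter.Eventually.of_forall step1)
  refine step2.trans ?_
  have rot : ∀ φ : ℝ, ∫ p, G p ∂(μ.prod μ) = ∫ p : (Fin n → ℝ) × (Fin n → ℝ),
      |hl b (l p.1 * cos φ + l p.2 * sin φ)
        - hl b (l p.1 * cos (φ + θ) + l p.2 * sin (φ + θ))| ∂(μ.prod μ) := by
    intro φ
    nth_rewrite 1 [← gauss_rot n φ]
    rw [integral_map (by fun_prop) Gm.aestronglyMeasurable]
    refine integral_congr_ae (Filter.Eventually.of_forall fun p => ?_)
    simp only [hG, ContinuousLinearMap.rotation_apply, ladd, cos_add, sin_add]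
    congr 3 <;> ring
  set K : ℝ → (Fin n → ℝ) × (Fin n → ℝ) → ℝ := fun φ p =>
    |hl b (l p.1 * cos φ + l p.2 * sin φ)
        - hl b (l p.1 * cos (φ + θ) + l p.2 * sin (φ + θ))| with hK
  have Km : Measurable (Function.uncurry K) := by
    refine (((hl_meas b).comp ?_).sub ((hl_meas b).comp ?_)).abs <;> fun_prop
  have : IsFiniteMeasure (volume.restrict (Set.uIoc 0 (2 * π))) := ⟨by simp [Set.uIoc]⟩
  have Ki : Integrable (Function.uncurry K)
      ((volume.restrict (Set.uIoc 0 (2 * π))).prod (μ.prod μ)) :=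
    Integrable.of_bound Km.aestronglyMeasurable 1 (Filter.Eventually.of_forall fun q => by
      simp only [Function.uncurry, hK, norm_eq_abs, abs_abs]; exact habs _ _)
  have avg : ∫ φ in (0)..(2 * π), (∫ p, G p ∂(μ.prod μ)) = ∫ p, (∫ φ in (0)..(2 * π), K φ p)
      ∂(μ.prod μ) := by
    rw [← intervalIntegral_integral_swap Ki]
    exact intervalIntegral.integral_congr fun φ _ => rot φ
  have fin : ∫ p, (∫ φ in (0)..(2 * π), K φ p) ∂(μ.prod μ) ≤ ∫ p, 2 * θ ∂(μ.prod μ) := by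
    refine integral_mono_of_nonneg (Filter.Eventually.of_forall fun p => ?_)
      (integrable_const _) (Filter.Eventually.of_forall fun p =>
        core _ _ b θ (arccos_nonneg _) (arccos_le_pi _))
    exact intervalIntegral.integral_nonneg (by positivity) fun φ _ => abs_nonneg _
  rw [← avg] at fin
  simp at fin
  rw [one_div, inv_mul_eq_div, le_div_iff₀ pi_pos]
  linarith
end

section
/- There is a universal constant C such that the following holds. Let A ⊆ ℝ^n be a half-space with 0 < γ_n(A) < 1, let f : ℝ^n → [0,1] be measurable, and let t > 0. Then Var(P_t f) ≥ (Cov(1_A, f)² / (γ_n(A)(1−γ_n(A)))²) · Var(P_t 1_A) − √(arccos(e^{−2t}))/√π, and moreover Var(P_t f) ≥ 4 Cov(1_A, f)² − C t^{1/4}. -/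
open MeasureTheory Real

open ProbabilityTheory in
lemma polar_meas (E : Set (ℝ × ℝ)) (hE : MeasurableSet E) :
    ((gaussianReal 0 1).prod (gaussianReal 0 1)) E =
      ∫⁻ r in Set.Ioi (0:ℝ), ENNReal.ofReal r * ENNReal.ofReal ((2*π)⁻¹ * exp (-r^2/2)) *
        volume ({θ | (r * cos θ, r * sin θ) ∈ E} ∩ Set.Ioo (-π) π) := by
  rw [gaussianReal_of_var_ne_zero _ one_ne_zero,
    prod_withDensity (measurable_gaussianPDF _ _) (measurable_gaussianPDF _ _),
    withDensity_apply _ hE, ← lintegral_indicator hE]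
  rw [← Measure.volume_eq_prod, ← lintegral_comp_polarCoord_symm]
  have ht : polarCoord.target = Set.Ioi (0:ℝ) ×ˢ Set.Ioo (-π) π := rfl
  have hs : ∀ p : ℝ × ℝ, polarCoord.symm p = (p.1 * cos p.2, p.1 * sin p.2) := fun _ => rfl
  have hm : Measurable (fun p : ℝ × ℝ => (p.1 * cos p.2, p.1 * sin p.2)) := by fun_prop
  rw [ht, Measure.volume_eq_prod, ← Measure.prod_restrict, lintegral_prod]
  · refine lintegral_congr fun r => ?_
    have h1 : ∀ θ : ℝ, ENNReal.ofReal (r, θ).1 • (E.indicator (fun z : ℝ × ℝ =>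
        gaussianPDF 0 1 z.1 * gaussianPDF 0 1 z.2) (polarCoord.symm (r, θ))) =
        Set.indicator {θ | (r * cos θ, r * sin θ) ∈ E} (fun _ => ENNReal.ofReal r *
          ENNReal.ofReal ((2*π)⁻¹ * exp (-r^2/2))) θ := by
      intro θ
      rw [hs]
      by_cases h : (r * cos θ, r * sin θ) ∈ E
      · have h' : θ ∈ {θ | (r * cos θ, r * sin θ) ∈ E} := h
        rw [Set.indicator_of_mem h, Set.indicator_of_mem h']
        simp only [gaussianPDF, smul_eq_mul]
        rw [← ENNReal.ofReal_mul (gaussianPDFReal_nonneg _ _ _)]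
        congr 2
        simp only [gaussianPDFReal, NNReal.coe_one, mul_one, sub_zero]
        rw [mul_mul_mul_comm, ← mul_inv, mul_self_sqrt (by positivity), ← exp_add]
        congr 2
        have := sin_sq_add_cos_sq θ
        linear_combination (-r^2/2) * this
      · have h' : θ ∉ {θ | (r * cos θ, r * sin θ) ∈ E} := h
        rw [Set.indicator_of_notMem h, Set.indicator_of_notMem h', smul_zero]
    simp_rw [h1]
    have hmE : MeasurableSet {θ : ℝ | (r * cos θ, r * sin θ) ∈ E} := by
      have : Measurable (fun θ : ℝ => (r * cos θ, r * sin θ)) := by fun_prop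
      exact this hE
    rw [lintegral_indicator hmE, lintegral_const, Measure.restrict_apply MeasurableSet.univ,
      Set.univ_inter, Measure.restrict_apply hmE]
  · apply Measurable.aemeasurable
    simp_rw [hs, smul_eq_mul]
    refine Measurable.mul (by fun_prop) ?_
    refine Measurable.comp (g := E.indicator (fun z : ℝ × ℝ =>
        gaussianPDF 0 1 z.1 * gaussianPDF 0 1 z.2)) ?_ hm
    refine Measurable.indicator ?_ hE
    exact ((measurable_gaussianPDF _ _).comp measurable_fst).mul
      ((measurable_gaussianPDF _ _).comp measurable_snd)

lemma angle_bound (m b α : ℝ) (hm : 0 ≤ m) (h0 : 0 ≤ α) (_h1 : α ≤ π) :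
    volume ({θ : ℝ | m * cos θ ≤ b ∧ b < m * cos (θ - α)} ∩ Set.Ioo (-π) π) ≤
      ENNReal.ofReal α := by
  by_cases hne : ({θ : ℝ | m * cos θ ≤ b ∧ b < m * cos (θ - α)}).Nonempty
  swap
  · rw [Set.not_nonempty_iff_eq_empty] at hne
    simp [hne]
  obtain ⟨θ0, h2, h3⟩ := hne
  have hm' : 0 < m := by
    rcases hm.eq_or_lt with h | h
    · subst h; simp at h2 h3; linarith
    · exact h
  have hb1 : b / m ≤ 1 := by
    rw [div_le_one hm']; nlinarith [cos_le_one (θ0 - α)]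
  have hb2 : -1 ≤ b / m := by
    rw [le_div_iff₀ hm']; nlinarith [neg_one_le_cos θ0]
  set s := arccos (b/m) with hs
  have hcs : cos s = b / m := cos_arccos hb2 hb1
  have hs0 : 0 ≤ s := arccos_nonneg _
  have hsp : s ≤ π := arccos_le_pi _
  have hb : b = m * cos s := by rw [hcs]; field_simp
  have key : ({θ : ℝ | m * cos θ ≤ b ∧ b < m * cos (θ - α)} ∩ Set.Ioo (-π) π) ⊆
      Set.Ico s (min (s + α) π) ∪ Set.Ioo (-π) (s + α - 2 * π) := by
    rintro θ ⟨⟨h4, h5⟩, h6, h7⟩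
    rw [hb] at h4 h5
    have h4' : cos θ ≤ cos s := le_of_mul_le_mul_left h4 hm'
    have h5' : cos s < cos (θ - α) := lt_of_mul_lt_mul_left h5 hm
    have h8 : s ≤ |θ| := by
      by_contra hc
      push Not at hc
      have := cos_lt_cos_of_nonneg_of_le_pi (abs_nonneg θ) hsp hc
      rw [cos_abs] at this
      linarith
    by_cases hc : -π ≤ θ - α
    · left
      have h9 : |θ - α| < s := by
        by_contra hc'
        push Not at hc'
        have := cos_le_cos_of_nonneg_of_le_pi hs0 (abs_le.2 ⟨hc, by linarith⟩) hc'
        rw [cos_abs] at this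
        linarith
      rw [abs_lt] at h9
      rcases le_abs.1 h8 with h | h
      · exact ⟨h, lt_min (by linarith) h7⟩
      · linarith
    · right
      push Not at hc
      refine ⟨h6, ?_⟩
      by_contra hc'
      push Not at hc'
      have := cos_le_cos_of_nonneg_of_le_pi hs0 (y := θ - α + 2 * π) (by linarith) (by linarith)
      rw [cos_add_two_pi] at this
      linarith
  refine (measure_mono key).trans ((measure_union_le _ _).trans ?_)
  rw [Real.volume_Ico, Real.volume_Ioo]
  rcases le_total (s + α) π with h | h
  · rw [min_eq_left h, ENNReal.ofReal_of_nonpos (p := s + α - 2*π - -π) (by linarith), add_zero]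
    apply ENNReal.ofReal_le_ofReal; linarith
  · rw [min_eq_right h, ← ENNReal.ofReal_add (by linarith) (by linarith)]
    apply ENNReal.ofReal_le_ofReal; linarith

open ProbabilityTheory in
lemma planar_bound (κ b α : ℝ) (hκ : 0 ≤ κ) (h0 : 0 ≤ α) (h1 : α ≤ π) :
    ((gaussianReal 0 1).prod (gaussianReal 0 1))
      {p : ℝ × ℝ | κ * p.1 ≤ b ∧ b < κ * (cos α * p.1 + sin α * p.2)} ≤
      ENNReal.ofReal (α / (2 * π)) := by
  have hmeas1 : MeasurableSet {p : ℝ × ℝ | κ * p.1 ≤ b} :=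
    measurableSet_le (by fun_prop) (by fun_prop)
  have hmeas2 : MeasurableSet {p : ℝ × ℝ | b < κ * (cos α * p.1 + sin α * p.2)} :=
    measurableSet_lt (by fun_prop) (by fun_prop)
  have hmeas : MeasurableSet {p : ℝ × ℝ | κ * p.1 ≤ b ∧ b < κ * (cos α * p.1 + sin α * p.2)} :=
    hmeas1.inter hmeas2
  have hdm : Measurable fun r : ℝ =>
    ENNReal.ofReal r * ENNReal.ofReal ((2*π)⁻¹ * exp (-r^2/2)) := by fun_prop
  have htot := polar_meas Set.univ MeasurableSet.univ
  rw [measure_univ] at htot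
  simp only [Set.mem_univ, Set.ofPred_true, Set.univ_inter, Real.volume_Ioo] at htot
  rw [lintegral_mul_const _ hdm] at htot
  set K := ∫⁻ r in Set.Ioi (0:ℝ), ENNReal.ofReal r * ENNReal.ofReal ((2*π)⁻¹ * exp (-r^2/2))
    with hK
  have hpi : (0:ℝ) < 2 * π := by positivity
  have hK' : K = ENNReal.ofReal (2*π)⁻¹ := by
    rw [ENNReal.ofReal_inv_of_pos hpi]
    apply ENNReal.eq_inv_of_mul_eq_one_left
    rw [htot]; congr 2; ring
  rw [polar_meas _ hmeas]
  calc _ ≤ ∫⁻ r in Set.Ioi (0:ℝ), ENNReal.ofReal r * ENNReal.ofReal ((2*π)⁻¹ * exp (-r^2/2)) *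
        ENNReal.ofReal α := by
        refine setLIntegral_mono (hdm.mul_const _) fun r hr => ?_
        gcongr
        refine le_trans (measure_mono ?_) (angle_bound (κ * r) b α
          (mul_nonneg hκ (le_of_lt hr)) h0 h1)
        rintro θ ⟨⟨h2, h3⟩, h4⟩
        refine ⟨⟨by simpa [mul_assoc] using h2, ?_⟩, h4⟩
        rw [cos_sub]
        simp only at h3
        linarith
    _ = K * ENNReal.ofReal α := by rw [lintegral_mul_const _ hdm]
    _ ≤ _ := by
        rw [hK', ← ENNReal.ofReal_mul (by positivity)]
        apply ENNReal.ofReal_le_ofReal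
        apply le_of_eq; field_simp

open ProbabilityTheory in
instance gauss_prob (n : ℕ) : IsProbabilityMeasure (gauss n) := by
  unfold gauss; infer_instance

open ProbabilityTheory in
lemma gaussianReal_cf (s : ℝ) :
    ∫ x : ℝ, Complex.exp (((x * s : ℝ) : ℂ) * Complex.I) ∂(gaussianReal 0 1) =
      Complex.exp (((-(s^2)/2 : ℝ) : ℂ)) := by
  have := charFun_gaussianReal (μ := 0) (v := 1) s
  rw [charFun_apply_real] at this
  simp only [Complex.ofReal_zero, mul_zero, zero_mul, zero_sub, NNReal.coe_one,
    Complex.ofReal_one, one_mul] at this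
  push_cast
  rw [neg_div, ← this]
  congr 1
  ext x
  ring_nf

lemma gauss_cf (n : ℕ) (c : Fin n → ℝ) :
    ∫ x, Complex.exp (((∑ i, x i * c i : ℝ) : ℂ) * Complex.I) ∂(gauss n) =
      Complex.exp (((-(∑ i, c i^2)/2 : ℝ) : ℂ)) := by
  unfold gauss
  have : ∀ x : Fin n → ℝ, Complex.exp (((∑ i, x i * c i : ℝ) : ℂ) * Complex.I) =
      ∏ i, Complex.exp (((x i * c i : ℝ) : ℂ) * Complex.I) := by
    intro x
    rw [← Complex.exp_sum, ← Finset.sum_mul, Complex.ofReal_sum]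
  simp_rw [this]
  rw [integral_fintype_prod_eq_prod (f := fun i (y : ℝ) =>
    Complex.exp (((y * c i : ℝ) : ℂ) * Complex.I))]
  simp_rw [gaussianReal_cf]
  rw [← Complex.exp_sum, ← Complex.ofReal_sum]
  congr 2
  rw [neg_div, Finset.sum_div, ← Finset.sum_neg_distrib]
  simp [neg_div]

noncomputable def gE (n : ℕ) (p x : Fin n → ℝ) : ℂ :=
  Complex.exp (((∑ i, x i * p i : ℝ) : ℂ) * Complex.I)

noncomputable def rE (p x : ℝ) : ℂ := Complex.exp (((x * p : ℝ) : ℂ) * Complex.I)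

/-- the sample space of a triple of independent Gaussian vectors -/
noncomputable def tri (n : ℕ) : Measure ((Fin n → ℝ) × ((Fin n → ℝ) × (Fin n → ℝ))) :=
  (gauss n).prod ((gauss n).prod (gauss n))

instance tri_prob (n : ℕ) : IsProbabilityMeasure (tri n) := by
  unfold tri; infer_instance

def tX (n : ℕ) (c σ : ℝ) (ω : (Fin n → ℝ) × ((Fin n → ℝ) × (Fin n → ℝ))) : Fin n → ℝ :=
  fun i => c * ω.1 i + σ * ω.2.1 i

def tY (n : ℕ) (c σ : ℝ) (ω : (Fin n → ℝ) × ((Fin n → ℝ) × (Fin n → ℝ))) : Fin n → ℝ :=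
  fun i => c * ω.1 i + σ * ω.2.2 i

lemma tX_meas (n : ℕ) (c σ : ℝ) : Measurable (tX n c σ) := by
  unfold tX; fun_prop

lemma tY_meas (n : ℕ) (c σ : ℝ) : Measurable (tY n c σ) := by
  unfold tY; fun_prop

lemma tri_cf (n : ℕ) (c σ : ℝ) (h : c^2 + σ^2 = 1) (p q : Fin n → ℝ) :
    ∫ ω, Complex.exp (((∑ i, tX n c σ ω i * p i + ∑ i, tY n c σ ω i * q i : ℝ) : ℂ) * Complex.I)
      ∂(tri n) =
    Complex.exp (((-(∑ i, p i^2 + ∑ i, q i^2 + 2 * c^2 * ∑ i, p i * q i)/2 : ℝ) : ℂ)) := by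
  have h1 : ∀ ω : (Fin n → ℝ) × ((Fin n → ℝ) × (Fin n → ℝ)),
      Complex.exp (((∑ i, tX n c σ ω i * p i + ∑ i, tY n c σ ω i * q i : ℝ) : ℂ) * Complex.I) =
      gE n (fun i => c * (p i + q i)) ω.1 *
      (gE n (fun i => σ * p i) ω.2.1 * gE n (fun i => σ * q i) ω.2.2) := by
    intro ω
    simp only [gE]
    rw [← Complex.exp_add, ← Complex.exp_add, ← add_mul, ← add_mul, ← Complex.ofReal_add,
      ← Complex.ofReal_add, ← Finset.sum_add_distrib, ← Finset.sum_add_distrib,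
      ← Finset.sum_add_distrib]
    congr 3
    refine Finset.sum_congr rfl fun i _ => ?_
    simp only [tX, tY]
    ring
  simp_rw [h1]
  unfold tri
  rw [integral_prod_mul (gE n (fun i => c * (p i + q i))) (fun z : (Fin n → ℝ) × (Fin n → ℝ) =>
    gE n (fun i => σ * p i) z.1 * gE n (fun i => σ * q i) z.2),
    integral_prod_mul (gE n (fun i => σ * p i)) (gE n (fun i => σ * q i))]
  unfold gE
  rw [gauss_cf, gauss_cf, gauss_cf, ← Complex.exp_add,
    ← Complex.exp_add, ← Complex.ofReal_add, ← Complex.ofReal_add]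
  congr 2
  have e1 : ∑ i, (c * (p i + q i))^2 = c^2 * ∑ i, p i^2 + c^2 * ∑ i, q i^2 +
      2 * c^2 * ∑ i, p i * q i := by
    simp only [Finset.mul_sum, ← Finset.sum_add_distrib]
    refine Finset.sum_congr rfl fun i _ => ?_
    ring
  have e2 : ∀ r : Fin n → ℝ, ∑ i, (σ * r i)^2 = σ^2 * ∑ i, r i^2 := by
    intro r
    simp only [Finset.mul_sum, mul_pow]
  rw [e1, e2, e2]
  linear_combination (-(∑ i, p i^2)/2 - (∑ i, q i^2)/2) * h

lemma dual_pi (n : ℕ) (T : StrongDual ℝ (Fin n → ℝ)) (v : Fin n → ℝ) :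
    T v = ∑ i, v i * T (Pi.single i 1) := by
  conv_lhs => rw [pi_eq_sum_univ' v]
  rw [map_sum]
  refine Finset.sum_congr rfl fun i _ => ?_
  rw [map_smul, smul_eq_mul]

lemma tX_law (n : ℕ) (c σ : ℝ) (h : c^2 + σ^2 = 1) : (tri n).map (tX n c σ) = gauss n := by
  have hm := tX_meas n c σ
  have : IsProbabilityMeasure ((tri n).map (tX n c σ)) := Measure.isProbabilityMeasure_map hm.aemeasurable
  refine Measure.ext_of_charFunDual (funext fun T => ?_)
  rw [charFunDual_apply, charFunDual_apply, integral_map hm.aemeasurable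
    (by apply Measurable.aestronglyMeasurable; fun_prop)]
  obtain ⟨w, hw⟩ : ∃ w : Fin n → ℝ, ∀ v, T v = ∑ i, v i * w i := ⟨_, dual_pi n T⟩
  simp_rw [hw]
  rw [gauss_cf]
  have := tri_cf n c σ h w 0
  simpa using this

lemma tY_law (n : ℕ) (c σ : ℝ) (h : c^2 + σ^2 = 1) : (tri n).map (tY n c σ) = gauss n := by
  have hm := tY_meas n c σ
  have : IsProbabilityMeasure ((tri n).map (tY n c σ)) := Measure.isProbabilityMeasure_map hm.aemeasurable
  refine Measure.ext_of_charFunDual (funext fun T => ?_)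
  rw [charFunDual_apply, charFunDual_apply, integral_map hm.aemeasurable
    (by apply Measurable.aestronglyMeasurable; fun_prop)]
  obtain ⟨w, hw⟩ : ∃ w : Fin n → ℝ, ∀ v, T v = ∑ i, v i * w i := ⟨_, dual_pi n T⟩
  simp_rw [hw]
  rw [gauss_cf]
  have := tri_cf n c σ h 0 w
  simpa using this

lemma law_bound {Ω : Type*} [MeasurableSpace Ω] (μ : Measure Ω) [IsProbabilityMeasure μ]
    (S T : Ω → ℝ) (hS : Measurable S) (hT : Measurable T) (κ α b : ℝ) (hκ : 0 ≤ κ) (h0 : 0 ≤ α)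
    (h1 : α ≤ π)
    (hcf : ∀ u v : ℝ, ∫ ω, Complex.exp (((S ω * u + T ω * v : ℝ) : ℂ) * Complex.I) ∂μ =
      Complex.exp (((-(κ^2 * (u^2 + v^2 + 2 * cos α * u * v))/2 : ℝ) : ℂ))) :
    μ {ω | S ω ≤ b ∧ b < T ω} ≤ ENNReal.ofReal (α / (2 * π)) := by
  set g := (ProbabilityTheory.gaussianReal 0 1).prod (ProbabilityTheory.gaussianReal 0 1) with hg
  have hm1 : Measurable (fun ω => (S ω, T ω)) := hS.prodMk hT
  have hm2 : Measurable (fun p : ℝ × ℝ => (κ * p.1, κ * (cos α * p.1 + sin α * p.2))) := by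
    fun_prop
  have hlaw : μ.map (fun ω => (S ω, T ω)) =
      g.map (fun p : ℝ × ℝ => (κ * p.1, κ * (cos α * p.1 + sin α * p.2))) := by
    have : IsProbabilityMeasure (μ.map (fun ω => (S ω, T ω))) :=
      Measure.isProbabilityMeasure_map hm1.aemeasurable
    have : IsProbabilityMeasure (g.map
        (fun p : ℝ × ℝ => (κ * p.1, κ * (cos α * p.1 + sin α * p.2)))) :=
      Measure.isProbabilityMeasure_map hm2.aemeasurable
    refine Measure.ext_of_charFunDual (funext fun L => ?_)
    rw [charFunDual_apply, charFunDual_apply, integral_map hm1.aemeasurable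
      (by apply Measurable.aestronglyMeasurable; fun_prop), integral_map hm2.aemeasurable
      (by apply Measurable.aestronglyMeasurable; fun_prop)]
    obtain ⟨u, v, hL⟩ : ∃ u v : ℝ, ∀ x y : ℝ, L (x, y) = x * u + y * v := by
      refine ⟨L (1, 0), L (0, 1), fun x y => ?_⟩
      have : ((x, y) : ℝ × ℝ) = x • (1, 0) + y • (0, 1) := by simp
      rw [this, map_add, map_smul, map_smul, smul_eq_mul, smul_eq_mul]
    simp_rw [hL]
    rw [hcf]
    have h2 : ∀ p : ℝ × ℝ, Complex.exp (((κ * p.1 * u + κ * (cos α * p.1 + sin α * p.2) * v : ℝ) : ℂ)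
        * Complex.I) =
        rE (κ * (u + cos α * v)) p.1 * rE (κ * sin α * v) p.2 := by
      intro p
      simp only [rE]
      rw [← Complex.exp_add, ← add_mul, ← Complex.ofReal_add]
      congr 3
      ring
    simp_rw [h2]
    rw [hg, integral_prod_mul (rE (κ * (u + cos α * v))) (rE (κ * sin α * v))]
    unfold rE
    rw [gaussianReal_cf, gaussianReal_cf, ← Complex.exp_add,
      ← Complex.ofReal_add]
    congr 2
    linear_combination (κ^2 * v^2 / 2) * (sin_sq_add_cos_sq α)
  have hm3 : MeasurableSet {p : ℝ × ℝ | p.1 ≤ b} := measurableSet_le (by fun_prop) (by fun_prop)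
  have hm4 : MeasurableSet {p : ℝ × ℝ | b < p.2} := measurableSet_lt (by fun_prop) (by fun_prop)
  have hm5 : MeasurableSet {p : ℝ × ℝ | p.1 ≤ b ∧ b < p.2} := hm3.inter hm4
  have h3 := congrArg (fun ν : Measure (ℝ × ℝ) => ν {p : ℝ × ℝ | p.1 ≤ b ∧ b < p.2}) hlaw
  rw [Measure.map_apply hm1 hm5, Measure.map_apply hm2 hm5] at h3
  refine le_trans (le_of_eq h3) (planar_bound κ b α hκ h0 h1)

lemma tri_bound (n : ℕ) (c σ : ℝ) (h : c^2 + σ^2 = 1) (a : Fin n → ℝ) (b : ℝ) :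
    (tri n) {ω | ∑ i, tX n c σ ω i * a i ≤ b ∧ b < ∑ i, tY n c σ ω i * a i} ≤
      ENNReal.ofReal (arccos (c^2) / (2 * π)) ∧
    (tri n) {ω | ∑ i, tY n c σ ω i * a i ≤ b ∧ b < ∑ i, tX n c σ ω i * a i} ≤
      ENNReal.ofReal (arccos (c^2) / (2 * π)) := by
  have hX := tX_meas n c σ
  have hY := tY_meas n c σ
  have hS : Measurable fun ω => ∑ i, tX n c σ ω i * a i := by fun_prop
  have hT : Measurable fun ω => ∑ i, tY n c σ ω i * a i := by fun_prop
  have hcos : cos (arccos (c^2)) = c^2 := cos_arccos (by nlinarith) (by nlinarith)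
  have hκ : (√(∑ i, a i^2))^2 = ∑ i, a i^2 := sq_sqrt (Finset.sum_nonneg fun i _ => sq_nonneg _)
  have key : ∀ u v : ℝ, -(∑ i, (u * a i)^2 + ∑ i, (v * a i)^2 + 2 * c^2 * ∑ i, (u * a i) * (v * a i))/2
      = -((√(∑ i, a i^2))^2 * (u^2 + v^2 + 2 * cos (arccos (c^2)) * u * v))/2 := by
    intro u v
    rw [hcos, hκ]
    have e2 : ∀ r : ℝ, ∑ i, (r * a i)^2 = r^2 * ∑ i, a i^2 := by
      intro r
      simp only [Finset.mul_sum, mul_pow]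
    have e3 : ∑ i, (u * a i) * (v * a i) = u * v * ∑ i, a i^2 := by
      rw [Finset.mul_sum]
      exact Finset.sum_congr rfl fun i _ => by ring
    rw [e2, e2, e3]; ring
  constructor
  · refine law_bound (tri n) _ _ hS hT (√(∑ i, a i^2)) _ b (sqrt_nonneg _) (arccos_nonneg _)
      (arccos_le_pi _) fun u v => ?_
    rw [← key u v, ← tri_cf n c σ h]
    congr 1; ext ω
    congr 3
    rw [Finset.sum_mul, Finset.sum_mul]
    congr 1 <;> exact Finset.sum_congr rfl fun i _ => by ring
  · refine law_bound (tri n) _ _ hT hS (√(∑ i, a i^2)) _ b (sqrt_nonneg _) (arccos_nonneg _)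
      (arccos_le_pi _) fun u v => ?_
    rw [show u^2 + v^2 + 2 * cos (arccos (c^2)) * u * v =
      v^2 + u^2 + 2 * cos (arccos (c^2)) * v * u by ring, ← key v u, ← tri_cf n c σ h]
    congr 1; ext ω
    congr 3
    rw [Finset.sum_mul, Finset.sum_mul, add_comm]
    congr 1 <;> exact Finset.sum_congr rfl fun i _ => by ring

/-- bounded measurable real functions -/
def BM {Ω : Type*} [MeasurableSpace Ω] (f : Ω → ℝ) : Prop := Measurable f ∧ ∃ K, ∀ x, |f x| ≤ K

lemma BM.int {Ω : Type*} [MeasurableSpace Ω] {f : Ω → ℝ} (h : BM f) (μ : Measure Ω)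
    [IsFiniteMeasure μ] : Integrable f μ := by
  obtain ⟨hm, K, hK⟩ := h
  exact Integrable.of_bound hm.aestronglyMeasurable K (Filter.Eventually.of_forall hK)

lemma BM.add {Ω : Type*} [MeasurableSpace Ω] {f g : Ω → ℝ} (hf : BM f) (hg : BM g) :
    BM (fun x => f x + g x) := by
  obtain ⟨hm, K, hK⟩ := hf
  obtain ⟨hm', K', hK'⟩ := hg
  exact ⟨hm.add hm', K + K', fun x => (abs_add_le _ _).trans (add_le_add (hK x) (hK' x))⟩

lemma BM.mul {Ω : Type*} [MeasurableSpace Ω] {f g : Ω → ℝ} (hf : BM f) (hg : BM g) :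
    BM (fun x => f x * g x) := by
  obtain ⟨hm, K, hK⟩ := hf
  obtain ⟨hm', K', hK'⟩ := hg
  refine ⟨hm.mul hm', K * K', fun x => ?_⟩
  rw [abs_mul]
  exact mul_le_mul (hK x) (hK' x) (abs_nonneg _) ((abs_nonneg _).trans (hK x))

lemma BM.const {Ω : Type*} [MeasurableSpace Ω] (r : ℝ) : BM (fun _ : Ω => r) :=
  ⟨measurable_const, |r|, fun _ => le_rfl⟩

lemma BM.sub {Ω : Type*} [MeasurableSpace Ω] {f g : Ω → ℝ} (hf : BM f) (hg : BM g) :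
    BM (fun x => f x - g x) := by
  have := hf.add ((BM.const (-1)).mul hg)
  refine (funext fun x => ?_ : (fun x => f x - g x) = _) ▸ this
  ring

lemma BM.comp {Ω Ω' : Type*} [MeasurableSpace Ω] [MeasurableSpace Ω'] {f : Ω → ℝ} (hf : BM f)
    {X : Ω' → Ω} (hX : Measurable X) : BM (fun ω => f (X ω)) := by
  obtain ⟨hm, K, hK⟩ := hf
  exact ⟨hm.comp hX, K, fun x => hK _⟩

/-- Cauchy-Schwarz for bounded functions -/
lemma cs_bm {Ω : Type*} [MeasurableSpace Ω] (μ : Measure Ω) [IsProbabilityMeasure μ]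
    {u v : Ω → ℝ} (hu : BM u) (hv : BM v) :
    (∫ ω, u ω * v ω ∂μ) ^ 2 ≤ (∫ ω, u ω * u ω ∂μ) * (∫ ω, v ω * v ω ∂μ) := by
  have h : ∀ s : ℝ, 0 ≤ (∫ ω, u ω * u ω ∂μ) * (s * s) + (2 * ∫ ω, u ω * v ω ∂μ) * s +
      (∫ ω, v ω * v ω ∂μ) := by
    intro s
    have h1 : 0 ≤ ∫ ω, (s * u ω + v ω) * (s * u ω + v ω) ∂μ :=
      integral_nonneg fun ω => mul_self_nonneg _
    have h2 : ∫ ω, (s * u ω + v ω) * (s * u ω + v ω) ∂μ =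
        (∫ ω, u ω * u ω ∂μ) * (s * s) + (2 * ∫ ω, u ω * v ω ∂μ) * s + (∫ ω, v ω * v ω ∂μ) := by
      have e : (fun ω => (s * u ω + v ω) * (s * u ω + v ω)) =
          fun ω => (s * s * (u ω * u ω) + 2 * s * (u ω * v ω)) + v ω * v ω := by
        funext ω; ring
      rw [e, integral_add ((((BM.const _).mul (hu.mul hu)).add
        ((BM.const _).mul (hu.mul hv))).int μ) ((hv.mul hv).int μ),
        integral_add (((BM.const _).mul (hu.mul hu)).int μ)
        (((BM.const _).mul (hu.mul hv)).int μ), integral_const_mul, integral_const_mul]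
      ring
    linarith
  have := discrim_le_zero h
  unfold discrim at this
  linarith

lemma abstract_bound {Ω : Type*} [MeasurableSpace Ω] (μ : Measure Ω) [IsProbabilityMeasure μ]
    {h1 h2 g1 g2 : Ω → ℝ} (bh1 : BM h1) (bh2 : BM h2) (bg1 : BM g1) (bg2 : BM g2)
    (l D : ℝ) (hl : |l| ≤ 1) (z1 : ∫ ω, h1 ω * g1 ω ∂μ = 0) (z2 : ∫ ω, h2 ω * g2 ω ∂μ = 0)
    (hp : 0 ≤ ∫ ω, g1 ω * g2 ω ∂μ) (q1 : ∫ ω, g1 ω * g1 ω ∂μ ≤ 1/4)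
    (q2 : ∫ ω, g2 ω * g2 ω ∂μ ≤ 1/4)
    (hD : ∫ ω, (h1 ω - h2 ω) * (h1 ω - h2 ω) ∂μ ≤ D) :
    l^2 * (∫ ω, h1 ω * h2 ω ∂μ) - √D ≤ ∫ ω, (g1 ω + l * h1 ω) * (g2 ω + l * h2 ω) ∂μ := by
  have hD0 : 0 ≤ D := le_trans (integral_nonneg fun ω => mul_self_nonneg _) hD
  have cs : ∀ g : Ω → ℝ, BM g → ∫ ω, g ω * g ω ∂μ ≤ 1/4 →
      |∫ ω, (h1 ω - h2 ω) * g ω ∂μ| ≤ √D / 2 := by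
    intro g bg q
    apply abs_le_of_sq_le_sq _ (by positivity)
    refine (cs_bm μ (bh1.sub bh2) bg).trans ?_
    rw [div_pow, sq_sqrt hD0]
    have : 0 ≤ ∫ ω, g ω * g ω ∂μ := integral_nonneg fun ω => mul_self_nonneg _
    nlinarith
  have c1 := cs g1 bg1 q1
  have c2 := cs g2 bg2 q2
  have e1 : ∫ ω, (h1 ω - h2 ω) * g1 ω ∂μ = - ∫ ω, h2 ω * g1 ω ∂μ := by
    simp_rw [sub_mul]
    rw [integral_sub ((bh1.mul bg1).int μ) ((bh2.mul bg1).int μ), z1, zero_sub]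
  have e2 : ∫ ω, (h1 ω - h2 ω) * g2 ω ∂μ = ∫ ω, h1 ω * g2 ω ∂μ := by
    simp_rw [sub_mul]
    rw [integral_sub ((bh1.mul bg2).int μ) ((bh2.mul bg2).int μ), z2, sub_zero]
  rw [e1, abs_neg] at c1
  rw [e2] at c2
  have ex : ∫ ω, (g1 ω + l * h1 ω) * (g2 ω + l * h2 ω) ∂μ = ∫ ω, g1 ω * g2 ω ∂μ +
      l * ∫ ω, h2 ω * g1 ω ∂μ + l * ∫ ω, h1 ω * g2 ω ∂μ + l^2 * ∫ ω, h1 ω * h2 ω ∂μ := by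
    have e : (fun ω => (g1 ω + l * h1 ω) * (g2 ω + l * h2 ω)) = fun ω =>
        ((g1 ω * g2 ω + l * (h2 ω * g1 ω)) + l * (h1 ω * g2 ω)) + l^2 * (h1 ω * h2 ω) := by
      funext ω; ring
    have i1 := bg1.mul bg2
    have i2 := (BM.const l).mul (bh2.mul bg1)
    have i3 := (BM.const l).mul (bh1.mul bg2)
    have i4 := (BM.const (l^2)).mul (bh1.mul bh2)
    rw [e, integral_add (((i1.add i2).add i3).int μ) (i4.int μ),
      integral_add ((i1.add i2).int μ) (i3.int μ), integral_add (i1.int μ) (i2.int μ),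
      integral_const_mul, integral_const_mul, integral_const_mul]
  rw [ex]
  have b1 : |l * ∫ ω, h2 ω * g1 ω ∂μ| ≤ √D / 2 := by
    rw [abs_mul]
    calc _ ≤ 1 * (√D / 2) := mul_le_mul hl c1 (abs_nonneg _) zero_le_one
      _ = _ := one_mul _
  have b2 : |l * ∫ ω, h1 ω * g2 ω ∂μ| ≤ √D / 2 := by
    rw [abs_mul]
    calc _ ≤ 1 * (√D / 2) := mul_le_mul hl c2 (abs_nonneg _) zero_le_one
      _ = _ := one_mul _
  linarith [(abs_le.1 b1).1, (abs_le.1 b2).1]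

lemma tri_prod (n : ℕ) (t : ℝ) {f g : (Fin n → ℝ) → ℝ} (hf : BM f) (hg : BM g) :
    ∫ ω, f (tX n (exp (-t)) (√(1 - exp (-2*t))) ω) * g (tY n (exp (-t)) (√(1 - exp (-2*t))) ω)
      ∂(tri n) = ∫ x, ou n t f x * ou n t g x ∂(gauss n) := by
  have hb := (hf.comp (tX_meas n (exp (-t)) (√(1 - exp (-2*t))))).mul
    (hg.comp (tY_meas n (exp (-t)) (√(1 - exp (-2*t)))))
  have hi := hb.int (tri n)
  unfold tri at hi ⊢
  rw [integral_prod _ hi]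
  congr 1
  ext x
  exact integral_prod_mul (fun y : Fin n → ℝ =>
    f (fun i => exp (-t) * x i + √(1 - exp (-2*t)) * y i)) (fun y : Fin n → ℝ =>
    g (fun i => exp (-t) * x i + √(1 - exp (-2*t)) * y i))

lemma sq_one (t : ℝ) (ht : 0 < t) : (exp (-t))^2 + (√(1 - exp (-2*t)))^2 = 1 := by
  rw [sq_sqrt, ← exp_nat_mul]
  · rw [show ((2:ℕ):ℝ) * -t = -2 * t by push_cast; ring]; ring
  · have : exp (-2*t) ≤ 1 := exp_le_one_iff.2 (by linarith)
    linarith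

lemma gvar_ou (n : ℕ) (t : ℝ) (ht : 0 < t) {f : (Fin n → ℝ) → ℝ} (hf : BM f) :
    gVar n (ou n t f) =
      ∫ ω, (f (tX n (exp (-t)) (√(1 - exp (-2*t))) ω) - gExp n f) *
        (f (tY n (exp (-t)) (√(1 - exp (-2*t))) ω) - gExp n f) ∂(tri n) := by
  have h1 := tri_prod n t hf (BM.const 1)
  have h2 : ∀ x, ou n t (fun _ => (1:ℝ)) x = 1 := by intro x; simp [ou]
  simp only [h2, mul_one] at h1
  have h3 : gExp n (ou n t f) = gExp n f := by
    unfold gExp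
    rw [← h1]
    conv_rhs => rw [← tX_law n _ _ (sq_one t ht)]
    rw [integral_map (tX_meas _ _ _).aemeasurable hf.1.aestronglyMeasurable]
  unfold gVar gCov
  rw [h3]
  have h4 := tri_prod n t (hf.sub (BM.const (gExp n f))) (hf.sub (BM.const (gExp n f)))
  rw [h4]
  have h5 : ∀ x, ou n t (fun x => f x - gExp n f) x = ou n t f x - gExp n f := by
    intro x
    unfold ou
    rw [integral_sub]
    · simp
    · exact (hf.comp (X := fun y : Fin n → ℝ =>
        (fun i => exp (-t) * x i + √(1 - exp (-2*t)) * y i)) (by fun_prop)).int _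
    · exact integrable_const _
  simp_rw [h5]
  rfl

lemma integral_tX (n : ℕ) (t : ℝ) (ht : 0 < t) {f : (Fin n → ℝ) → ℝ} (hf : BM f) :
    ∫ ω, f (tX n (exp (-t)) (√(1 - exp (-2*t))) ω) ∂(tri n) = ∫ x, f x ∂(gauss n) := by
  conv_rhs => rw [← tX_law n _ _ (sq_one t ht)]
  rw [integral_map (tX_meas _ _ _).aemeasurable hf.1.aestronglyMeasurable]

lemma integral_tY (n : ℕ) (t : ℝ) (ht : 0 < t) {f : (Fin n → ℝ) → ℝ} (hf : BM f) :
    ∫ ω, f (tY n (exp (-t)) (√(1 - exp (-2*t))) ω) ∂(tri n) = ∫ x, f x ∂(gauss n) := by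
  conv_rhs => rw [← tY_law n _ _ (sq_one t ht)]
  rw [integral_map (tY_meas _ _ _).aemeasurable hf.1.aestronglyMeasurable]

lemma bm_ind {n : ℕ} {A : Set (Fin n → ℝ)} (hA : MeasurableSet A) :
    BM (Set.indicator A (1 : (Fin n → ℝ) → ℝ)) := by
  refine ⟨measurable_one.indicator hA, 1, fun x => ?_⟩
  by_cases h : x ∈ A <;> simp [h]

lemma D_bound (n : ℕ) (t : ℝ) (ht : 0 < t) (a : Fin n → ℝ) (b : ℝ) (A : Set (Fin n → ℝ))
    (hA : A = {x | ∑ i, x i * a i ≤ b}) (hAm : MeasurableSet A) (p : ℝ) :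
    ∫ ω, ((Set.indicator A (1 : (Fin n → ℝ) → ℝ) (tX n (exp (-t)) (√(1 - exp (-2*t))) ω) - p) -
      (Set.indicator A (1 : (Fin n → ℝ) → ℝ) (tY n (exp (-t)) (√(1 - exp (-2*t))) ω) - p)) *
      ((Set.indicator A (1 : (Fin n → ℝ) → ℝ) (tX n (exp (-t)) (√(1 - exp (-2*t))) ω) - p) -
      (Set.indicator A (1 : (Fin n → ℝ) → ℝ) (tY n (exp (-t)) (√(1 - exp (-2*t))) ω) - p)) ∂(tri n)
      ≤ arccos (exp (-2*t)) / π := by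
  set c := exp (-t)
  set σ := √(1 - exp (-2*t))
  have hc : c^2 = exp (-2*t) := by
    rw [← exp_nat_mul]; congr 1; push_cast; ring
  obtain ⟨k1, k2⟩ := tri_bound n c σ (sq_one t ht) a b
  rw [hc] at k1 k2
  set E1 := {ω | ∑ i, tX n c σ ω i * a i ≤ b ∧ b < ∑ i, tY n c σ ω i * a i}
  set E2 := {ω | ∑ i, tY n c σ ω i * a i ≤ b ∧ b < ∑ i, tX n c σ ω i * a i}
  have hX := tX_meas n c σ
  have hY := tY_meas n c σ
  have hS : Measurable fun ω => ∑ i, tX n c σ ω i * a i := by fun_prop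
  have hT : Measurable fun ω => ∑ i, tY n c σ ω i * a i := by fun_prop
  have m1 : MeasurableSet E1 := (measurableSet_le hS measurable_const).inter
    (measurableSet_lt measurable_const hT)
  have m2 : MeasurableSet E2 := (measurableSet_le hT measurable_const).inter
    (measurableSet_lt measurable_const hS)
  have e : ∀ ω, ((Set.indicator A (1 : (Fin n → ℝ) → ℝ) (tX n c σ ω) - p) -
      (Set.indicator A (1 : (Fin n → ℝ) → ℝ) (tY n c σ ω) - p)) *
      ((Set.indicator A (1 : (Fin n → ℝ) → ℝ) (tX n c σ ω) - p) -
      (Set.indicator A (1 : (Fin n → ℝ) → ℝ) (tY n c σ ω) - p)) =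
      E1.indicator 1 ω + E2.indicator 1 ω := by
    intro ω
    have hx : tX n c σ ω ∈ A ↔ ∑ i, tX n c σ ω i * a i ≤ b := by rw [hA]; rfl
    have hy : tY n c σ ω ∈ A ↔ ∑ i, tY n c σ ω i * a i ≤ b := by rw [hA]; rfl
    have he1 : ω ∈ E1 ↔ (tX n c σ ω ∈ A ∧ tY n c σ ω ∉ A) := by rw [hx, hy, not_le]; rfl
    have he2 : ω ∈ E2 ↔ (tY n c σ ω ∈ A ∧ tX n c σ ω ∉ A) := by rw [hx, hy, not_le]; rfl
    by_cases h1 : tX n c σ ω ∈ A <;> by_cases h2 : tY n c σ ω ∈ A <;>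
      simp [Set.indicator, he1, he2, h1, h2] <;> ring
  simp_rw [e]
  have i1 : Integrable (E1.indicator (1 : (Fin n → ℝ) × ((Fin n → ℝ) × (Fin n → ℝ)) → ℝ)) (tri n) :=
    (integrable_const (1:ℝ)).indicator m1
  have i2 : Integrable (E2.indicator (1 : (Fin n → ℝ) × ((Fin n → ℝ) × (Fin n → ℝ)) → ℝ)) (tri n) :=
    (integrable_const (1:ℝ)).indicator m2
  rw [integral_add i1 i2, integral_indicator_one m1, integral_indicator_one m2]
  have h0 : 0 ≤ arccos (exp (-2*t)) / (2 * π) := div_nonneg (arccos_nonneg _) (by positivity)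
  have k1' : (tri n).real E1 ≤ arccos (exp (-2*t)) / (2 * π) := ENNReal.toReal_le_of_le_ofReal h0 k1
  have k2' : (tri n).real E2 ≤ arccos (exp (-2*t)) / (2 * π) := ENNReal.toReal_le_of_le_ofReal h0 k2
  have : arccos (exp (-2*t)) / π = arccos (exp (-2*t)) / (2 * π) + arccos (exp (-2*t)) / (2 * π) := by
    field_simp; ring
  linarith

lemma arccos_bound (t : ℝ) (ht : 0 < t) : √(arccos (exp (-2*t))) / √π ≤ t ^ ((1:ℝ)/4) := by
  set α := arccos (exp (-2*t)) with hα
  have h0 : 0 ≤ α := arccos_nonneg _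
  have h1 : cos α = exp (-2*t) := cos_arccos (by linarith [exp_pos (-2*t)])
    (exp_le_one_iff.2 (by linarith))
  have h2 := cos_le_one_sub_mul_cos_sq (x := α) (by rw [abs_of_nonneg h0]; exact arccos_le_pi _)
  have h3 := add_one_le_exp (-2*t)
  have h4 : (α / π)^2 ≤ t := by
    have : 2 / π^2 * α^2 = 2 * (α/π)^2 := by field_simp
    linarith
  rw [← sqrt_div h0]
  have h5 : α / π ≤ √t := le_sqrt_of_sq_le h4
  calc √(α / π) ≤ √(√t) := sqrt_le_sqrt h5
    _ = _ := by
      rw [sqrt_eq_rpow, sqrt_eq_rpow, ← rpow_mul ht.le]; norm_num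

lemma final_arith (l V d s T W x cv : ℝ) (hl : |l| ≤ 1) (hV : 0 < V) (hV4 : V ≤ 1/4)
    (hd0 : 0 ≤ d) (hcv : l * V = cv) (hW : V - d / 2 ≤ W) (hds : d ≤ s) (hsT : s ≤ T)
    (hx : l^2 * W - s ≤ x) : 4 * cv^2 - 2 * T ≤ x := by
  have hl2 : l^2 ≤ 1 := by
    rw [← sq_abs]; nlinarith [abs_nonneg l]
  have h4 : 4 * cv^2 ≤ l^2 * V := by
    rw [← hcv]
    have : 0 ≤ l^2 * V * (1 - 4 * V) := mul_nonneg (mul_nonneg (sq_nonneg _) hV.le) (by linarith)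
    nlinarith
  have h5 : l^2 * (V - d / 2) ≤ l^2 * W := mul_le_mul_of_nonneg_left hW (sq_nonneg _)
  have h6 : l^2 * (d / 2) ≤ 1 * (d / 2) := mul_le_mul_of_nonneg_right hl2 (by linarith)
  linarith

lemma le_sqrt_self (d : ℝ) (h0 : 0 ≤ d) (h1 : d ≤ 1) : d ≤ √d := by
  apply le_sqrt_of_sq_le
  nlinarith

set_option maxHeartbeats 1000000 in
lemma main_bound (n : ℕ) (A : Set (Fin n → ℝ)) (f : (Fin n → ℝ) → ℝ)
    (t : ℝ) (hA : IsHalfspace A) (hp0 : 0 < (gauss n A).toReal) (hp1 : (gauss n A).toReal < 1)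
    (hf : Measurable f) (hf01 : ∀ x, f x ∈ Set.Icc (0:ℝ) 1) (ht : 0 < t) :
    gVar n (ou n t f) ≥
      (gCov n (Set.indicator A 1) f) ^ 2 /
          ((gauss n A).toReal * (1 - (gauss n A).toReal)) ^ 2 *
        gVar n (ou n t (Set.indicator A 1)) -
        Real.sqrt (Real.arccos (Real.exp (-2*t))) / Real.sqrt Real.pi ∧
    gVar n (ou n t f) ≥
      4 * (gCov n (Set.indicator A 1) f) ^ 2 - 2 * t ^ ((1:ℝ)/4) := by
  obtain ⟨a, b, hAe⟩ := hA
  have hAm : MeasurableSet A := by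
    rw [hAe]; exact measurableSet_le (by fun_prop) measurable_const
  set p := (gauss n A).toReal with hp
  set ι : (Fin n → ℝ) → ℝ := Set.indicator A 1 with hι
  have bι : BM ι := bm_ind hAm
  have bf : BM f := ⟨hf, 1, fun x => abs_le.2 ⟨by linarith [(hf01 x).1], (hf01 x).2⟩⟩
  have Eι : gExp n ι = p := by
    unfold gExp
    rw [hι, integral_indicator_one hAm]; rfl
  set m := gExp n f with hm
  set V := p * (1 - p) with hV
  have hVpos : 0 < V := mul_pos hp0 (by linarith)
  have hV4 : V ≤ 1/4 := by nlinarith [sq_nonneg (p - 1/2)]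
  have ιv : ∀ x, ι x = 0 ∨ ι x = 1 := by
    intro x
    by_cases h : x ∈ A <;> simp [hι, h]
  have ιι : ∀ x, ι x * ι x = ι x := by
    intro x
    rcases ιv x with h | h <;> rw [h] <;> norm_num
  set H : (Fin n → ℝ) → ℝ := fun x => ι x - p with hH
  set F : (Fin n → ℝ) → ℝ := fun x => f x - m with hF
  have bH : BM H := bι.sub (BM.const p)
  have bF : BM F := bf.sub (BM.const m)
  set cv := gCov n ι f with hcv
  have cvE : cv = ∫ x, H x * F x ∂(gauss n) := by
    rw [hcv, gCov, Eι]; rfl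
  have iι : ∫ x, ι x ∂(gauss n) = p := Eι
  have i_f : ∫ x, f x ∂(gauss n) = m := rfl
  have iH : ∫ x, H x ∂(gauss n) = 0 := by
    rw [hH, integral_sub (bι.int _) (integrable_const _), iι]; simp
  have cvE' : cv = ∫ x, H x * f x ∂(gauss n) := by
    rw [cvE]
    have : (fun x => H x * F x) = fun x => H x * f x - H x * m := by
      funext x; simp only [hF]; ring
    rw [this, integral_sub ((bH.mul bf).int _) ((bH.mul (BM.const m)).int _),
      integral_mul_const, iH]
    ring
  have iHι : ∫ x, H x * ι x ∂(gauss n) = V := by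
    have : (fun x => H x * ι x) = fun x => (1 - p) * ι x := by
      funext x; simp only [hH]; linear_combination ιι x
    rw [this, integral_const_mul, iι]; ring
  have iHH : ∫ x, H x * H x ∂(gauss n) = V := by
    have : (fun x => H x * H x) = fun x => H x * ι x - H x * p := by
      funext x; simp only [hH]; ring
    rw [this, integral_sub ((bH.mul bι).int _) ((bH.mul (BM.const p)).int _),
      integral_mul_const, iH, iHι]
    ring
  have cv1 : cv ≤ V := by
    rw [cvE', ← iHι]
    refine integral_mono ((bH.mul bf).int _) ((bH.mul bι).int _) fun x => ?_
    simp only [hH]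
    obtain ⟨q1, q2⟩ := hf01 x
    rcases ιv x with h | h <;> rw [h] <;> nlinarith
  have cv2 : -V ≤ cv := by
    have : ∫ x, H x * (1 - ι x) ∂(gauss n) = -V := by
      have : (fun x => H x * (1 - ι x)) = fun x => H x - H x * ι x := by funext x; ring
      rw [this, integral_sub (bH.int _) ((bH.mul bι).int _), iH, iHι]; ring
    rw [cvE', ← this]
    refine integral_mono ((bH.mul ((BM.const 1).sub bι)).int _) ((bH.mul bf).int _) fun x => ?_
    simp only [hH]
    obtain ⟨q1, q2⟩ := hf01 x
    rcases ιv x with h | h <;> rw [h] <;> nlinarith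
  set l := cv / V with hl
  have hlV : l * V = cv := by rw [hl]; field_simp
  have hl1 : |l| ≤ 1 := by
    rw [hl, abs_div, abs_of_pos hVpos, div_le_one hVpos]
    exact abs_le.2 ⟨cv2, cv1⟩
  set G : (Fin n → ℝ) → ℝ := fun x => F x - l * H x with hG
  have bG : BM G := bF.sub ((BM.const l).mul bH)
  have iHG : ∫ x, H x * G x ∂(gauss n) = 0 := by
    have : (fun x => H x * G x) = fun x => H x * F x - l * (H x * H x) := by
      funext x; simp only [hG]; ring
    rw [this, integral_sub ((bH.mul bF).int _) (((BM.const l).mul (bH.mul bH)).int _),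
      integral_const_mul, iHH, ← cvE, hlV, sub_self]
  have iFF : ∫ x, F x * F x ∂(gauss n) ≤ 1/4 := by
    have e : (fun x => F x * F x) = fun x => (f x * f x - 2 * m * f x) + m^2 := by
      funext x; simp only [hF]; ring
    rw [e, integral_add (((bf.mul bf).sub ((BM.const _).mul bf)).int _) (integrable_const _),
      integral_sub ((bf.mul bf).int _) (((BM.const _).mul bf).int _), integral_const_mul, i_f]
    have : ∫ x, f x * f x ∂(gauss n) ≤ m := by
      rw [← i_f]
      refine integral_mono ((bf.mul bf).int _) (bf.int _) fun x => ?_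
      obtain ⟨q1, q2⟩ := hf01 x
      simp only
      nlinarith
    simp only [integral_const, probReal_univ, one_smul]
    nlinarith [sq_nonneg (m - 1/2)]
  have iGG : ∫ x, G x * G x ∂(gauss n) ≤ 1/4 := by
    have e : (fun x => F x * F x) = fun x => (G x * G x + 2 * l * (H x * G x)) + l^2 * (H x * H x) := by
      funext x; simp only [hG]; ring
    rw [e, integral_add (((bG.mul bG).add ((BM.const _).mul (bH.mul bG))).int _)
      (((BM.const _).mul (bH.mul bH)).int _),
      integral_add ((bG.mul bG).int _) (((BM.const _).mul (bH.mul bG)).int _),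
      integral_const_mul, integral_const_mul, iHG, iHH] at iFF
    nlinarith [mul_nonneg (sq_nonneg l) hVpos.le]
  set α := arccos (exp (-2*t)) with hα
  have hα0 : 0 ≤ α := arccos_nonneg _
  have hD := D_bound n t ht a b A hAe hAm p
  have vf := gvar_ou n t ht bf
  have vι := gvar_ou n t ht bι
  rw [Eι] at vι
  have mX := tX_meas n (exp (-t)) (√(1 - exp (-2*t)))
  have mY := tY_meas n (exp (-t)) (√(1 - exp (-2*t)))
  have hpos : 0 ≤ ∫ ω, G (tX n (exp (-t)) (√(1 - exp (-2*t))) ω) *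
      G (tY n (exp (-t)) (√(1 - exp (-2*t))) ω) ∂(tri n) := by
    rw [tri_prod n t bG bG]
    exact integral_nonneg fun x => mul_self_nonneg _
  have key := abstract_bound (tri n) (bH.comp mX) (bH.comp mY) (bG.comp mX) (bG.comp mY) l (α / π)
    hl1 ((integral_tX n t ht (bH.mul bG)).trans iHG) ((integral_tY n t ht (bH.mul bG)).trans iHG)
    hpos ((integral_tX n t ht (bG.mul bG)).trans_le iGG)
    ((integral_tY n t ht (bG.mul bG)).trans_le iGG) hD
  have eF : ∀ x, G x + l * H x = f x - m := by
    intro x; simp only [hG, hF]; ring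
  simp only [eF] at key
  rw [← hm] at vf
  rw [← vf] at key
  have vι' : gVar n (ou n t ι) = ∫ ω, H (tX n (exp (-t)) (√(1 - exp (-2*t))) ω) *
      H (tY n (exp (-t)) (√(1 - exp (-2*t))) ω) ∂(tri n) := vι
  rw [← vι', sqrt_div hα0] at key
  have part1 : gVar n (ou n t f) ≥ cv ^ 2 / V ^ 2 * gVar n (ou n t ι) - √α / √π := by
    rw [← div_pow]; exact key
  refine ⟨part1, ?_⟩
  -- the variance of `P_t 1_A`
  have hvar : V - α / π / 2 ≤ gVar n (ou n t ι) := by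
    have i1 := (integral_tX n t ht (bH.mul bH)).trans iHH
    have i2 := (integral_tY n t ht (bH.mul bH)).trans iHH
    have hD' : ∫ ω, (H (tX n (exp (-t)) (√(1 - exp (-2*t))) ω) -
        H (tY n (exp (-t)) (√(1 - exp (-2*t))) ω)) * (H (tX n (exp (-t)) (√(1 - exp (-2*t))) ω) -
        H (tY n (exp (-t)) (√(1 - exp (-2*t))) ω)) ∂(tri n) ≤ α / π := hD
    rw [vι']
    have b1 := bH.comp mX
    have b2 := bH.comp mY
    have e : (fun ω => (H (tX n (exp (-t)) (√(1 - exp (-2*t))) ω) -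
        H (tY n (exp (-t)) (√(1 - exp (-2*t))) ω)) * (H (tX n (exp (-t)) (√(1 - exp (-2*t))) ω) -
        H (tY n (exp (-t)) (√(1 - exp (-2*t))) ω))) = fun ω =>
        (H (tX n (exp (-t)) (√(1 - exp (-2*t))) ω) * H (tX n (exp (-t)) (√(1 - exp (-2*t))) ω) +
        H (tY n (exp (-t)) (√(1 - exp (-2*t))) ω) * H (tY n (exp (-t)) (√(1 - exp (-2*t))) ω)) -
        2 * (H (tX n (exp (-t)) (√(1 - exp (-2*t))) ω) *
          H (tY n (exp (-t)) (√(1 - exp (-2*t))) ω)) := by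
      funext ω; ring
    rw [e, integral_sub (((b1.mul b1).add (b2.mul b2)).int _)
      (((BM.const 2).mul (b1.mul b2)).int _), integral_add ((b1.mul b1).int _)
      ((b2.mul b2).int _), integral_const_mul, i1, i2] at hD'
    linarith
  have hb := arccos_bound t ht
  rw [← hα] at hb
  have hs : α / π ≤ √α / √π := by
    rw [← sqrt_div hα0]
    exact le_sqrt_self _ (div_nonneg hα0 pi_pos.le)
      (by rw [div_le_one pi_pos]; exact arccos_le_pi _)
  exact final_arith l V (α / π) (√α / √π) _ _ _ cv hl1 hVpos hV4 (div_nonneg hα0 pi_pos.le) hlV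
    hvar hs hb key

theorem stmt9 : ∃ C : ℝ, ∀ (n : ℕ) (A : Set (Fin n → ℝ)) (f : (Fin n → ℝ) → ℝ)
    (t : ℝ), IsHalfspace A → 0 < (gauss n A).toReal → (gauss n A).toReal < 1 →
    Measurable f → (∀ x, f x ∈ Set.Icc (0:ℝ) 1) → 0 < t →
    gVar n (ou n t f) ≥
      (gCov n (Set.indicator A 1) f) ^ 2 /
          ((gauss n A).toReal * (1 - (gauss n A).toReal)) ^ 2 *
        gVar n (ou n t (Set.indicator A 1)) -
        Real.sqrt (Real.arccos (Real.exp (-2*t))) / Real.sqrt Real.pi ∧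
    gVar n (ou n t f) ≥
      4 * (gCov n (Set.indicator A 1) f) ^ 2 - C * t ^ ((1:ℝ)/4) := by
  exact ⟨2, fun n A f t h1 h2 h3 h4 h5 h6 => main_bound n A f t h1 h2 h3 h4 h5 h6⟩
end

section
/- For m ≥ 1 let n = m², partition {1,…,n} into m consecutive blocks J_1,…,J_m of size m, and let B^{(m)} = { x ∈ {−1,1}^n : Σ_{i=1}^m ( m^{−1/2} Σ_{j∈J_i} x_j )² ≤ m }. Then for every fixed t > 0, liminf_{m→∞} Var(P_t 1_{B^{(m)}}) ≥ 1/4 − arccos(e^{−2t})/(√2 · π). In particular the sequence (B^{(m)}) is noise stable. -/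
open Real

/-- The `±1` value of a boolean coordinate. -/
noncomputable def bval (b : Bool) : ℝ := if b then 1 else -1

/-- Expectation with respect to the uniform measure on the discrete cube `{-1,1}^n`. -/
noncomputable def bExp (n : ℕ) (f : (Fin n → Bool) → ℝ) : ℝ :=
  (∑ x : Fin n → Bool, f x) / 2 ^ n

/-- Covariance on the discrete cube. -/
noncomputable def bCov (n : ℕ) (f g : (Fin n → Bool) → ℝ) : ℝ :=
  bExp n (fun x => (f x - bExp n f) * (g x - bExp n g))

/-- Variance on the discrete cube. -/
noncomputable def bVar (n : ℕ) (f : (Fin n → Bool) → ℝ) : ℝ := bCov n f f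

/-- The character `χ_S(x) = ∏_{i ∈ S} x_i`. -/
noncomputable def chi (n : ℕ) (S : Finset (Fin n)) (x : Fin n → Bool) : ℝ :=
  ∏ i ∈ S, bval (x i)

/-- The Fourier coefficient `f̂(S) = E[f χ_S]`. -/
noncomputable def fourierCoef (n : ℕ) (f : (Fin n → Bool) → ℝ) (S : Finset (Fin n)) : ℝ :=
  bExp n (fun x => f x * chi n S x)

/-- The Bonami--Beckner semigroup `P_t f = Σ_S e^{-t|S|} f̂(S) χ_S`. -/
noncomputable def bP (n : ℕ) (t : ℝ) (f : (Fin n → Bool) → ℝ) : (Fin n → Bool) → ℝ :=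
  fun x => ∑ S : Finset (Fin n), Real.exp (-t * S.card) * fourierCoef n f S * chi n S x

/-- A half-space `{x : ⟨a, x⟩ ≤ b}` in `{-1,1}^n`. -/
def IsHalfspaceB {n : ℕ} (A : Set (Fin n → Bool)) : Prop :=
  ∃ (a : Fin n → ℝ) (b : ℝ), A = {x | ∑ i, a i * bval (x i) ≤ b}

/-- `M(g)`: the supremum over half-spaces `A` of `Cov(g, 1_A)`. -/
noncomputable def Mb (n : ℕ) (g : (Fin n → Bool) → ℝ) : ℝ :=
  ⨆ A : {A : Set (Fin n → Bool) // IsHalfspaceB A}, bCov n g (Set.indicator A.1 1)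

/-- `z ⊘ x`: coordinates where `z` is `none` (i.e. 0) are filled in by `x`. -/
def oslash {n : ℕ} (z : Fin n → Option Bool) (x : Fin n → Bool) : Fin n → Bool :=
  fun i => (z i).getD (x i)

/-- The restriction `f_z(x) = f(z ⊘ x)`. -/
noncomputable def restrictF {n : ℕ} (f : (Fin n → Bool) → ℝ) (z : Fin n → Option Bool) :
    (Fin n → Bool) → ℝ := fun x => f (oslash z x)

/-- The `μ_s`-probability of the restriction pattern `z ∈ {-1,0,1}^n`: each coordinate is
independently `0` (here `none`) with probability `e^{-s}`, and `±1` with probability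
`(1-e^{-s})/2` each. -/
noncomputable def muWeight (n : ℕ) (s : ℝ) (z : Fin n → Option Bool) : ℝ :=
  ∏ i, if z i = none then Real.exp (-s) else (1 - Real.exp (-s)) / 2

/-- Expectation over a random restriction `Z ∼ μ_s`. -/
noncomputable def restExp (n : ℕ) (s : ℝ) (g : (Fin n → Option Bool) → ℝ) : ℝ :=
  ∑ z : Fin n → Option Bool, muWeight n s z * g z

/-- `w₁(f) = Σ_i f̂({i})²`. -/
noncomputable def w1b (n : ℕ) (f : (Fin n → Bool) → ℝ) : ℝ :=
  ∑ i : Fin n, (fourierCoef n f {i}) ^ 2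

/-- The boolean version of the ball example: `n = m²`, the coordinates are split into `m`
consecutive blocks `J_i = {j : j / m = i}` of size `m`, and
`B^{(m)} = {x : Σ_i (m^{-1/2} Σ_{j ∈ J_i} x_j)² ≤ m}`. -/
noncomputable def Bm (m : ℕ) : Set (Fin (m*m) → Bool) :=
  {x | ∑ i : Fin m,
    ((∑ j : Fin (m*m), if (j : ℕ) / m = (i : ℕ) then bval (x j) else 0) / Real.sqrt m) ^ 2
      ≤ (m : ℝ)}



/-- Law of one pair of `ρ`-correlated signs. -/
noncomputable def nsW (ρ : ℝ) (p : Bool × Bool) : ℝ := (1 + ρ * bval p.1 * bval p.2) / 4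

/-- Expectation over a family of independent `ρ`-correlated pairs of signs. -/
noncomputable def nsE {ι : Type*} [Fintype ι] [DecidableEq ι] (ρ : ℝ)
    (F : (ι → Bool × Bool) → ℝ) : ℝ :=
  ∑ z : ι → Bool × Bool, (∏ j, nsW ρ (z j)) * F z

lemma bval_sq (b : Bool) : bval b ^ 2 = 1 := by cases b <;> simp [bval]

lemma bval_true : bval true = 1 := by simp [bval]
lemma bval_false : bval false = -1 := by simp [bval]

lemma bP_eq (n : ℕ) (t : ℝ) (f : (Fin n → Bool) → ℝ) (x : Fin n → Bool) :
    bP n t f x = ∑ y, f y / 2 ^ n * ∏ i, (1 + Real.exp (-t) * bval (y i) * bval (x i)) := by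
  unfold bP fourierCoef bExp chi
  simp_rw [Finset.prod_one_add, Finset.mul_sum]
  rw [Finset.sum_comm]
  simp only [Finset.powerset_univ]
  refine Finset.sum_congr rfl fun S _ => ?_
  rw [Finset.sum_div, Finset.mul_sum, Finset.sum_mul]
  refine Finset.sum_congr rfl fun y _ => ?_
  rw [Finset.prod_mul_distrib, Finset.prod_mul_distrib, Finset.prod_const]
  rw [← Real.exp_nat_mul]
  rw [show -t * (S.card:ℝ) = S.card * -t by ring]
  ring

lemma bExp_bP (n : ℕ) (t : ℝ) (f : (Fin n → Bool) → ℝ) :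
    bExp n (bP n t f) = bExp n f := by
  unfold bExp
  congr 1
  simp_rw [bP_eq]
  rw [Finset.sum_comm]
  refine Finset.sum_congr rfl fun y _ => ?_
  rw [← Finset.mul_sum]
  have h := Fintype.prod_sum (fun (i : Fin n) (b : Bool) => 1 + Real.exp (-t) * bval (y i) * bval b)
  rw [← h]
  have : ∀ i : Fin n, ∑ b : Bool, (1 + Real.exp (-t) * bval (y i) * bval b) = 2 := by
    intro i; simp [bval]; ring
  simp only [this]
  simp

lemma sum_pair {n : ℕ} (G : (Fin n → Bool) → (Fin n → Bool) → ℝ) :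
    ∑ z : Fin n → Bool × Bool, G (fun i => (z i).1) (fun i => (z i).2) = ∑ x, ∑ y, G x y := by
  rw [← Fintype.sum_prod_type' (f := G)]
  exact Fintype.sum_equiv (Equiv.arrowProdEquivProdArrow (Fin n) (fun _ => Bool) (fun _ => Bool)) _ _ (fun z => rfl)

lemma bExp_sq_bP (n : ℕ) (t : ℝ) (f : (Fin n → Bool) → ℝ) :
    bExp n (fun x => bP n t f x * bP n t f x) =
      nsE (Real.exp (-2 * t)) (fun z => f (fun i => (z i).1) * f (fun i => (z i).2)) := by
  unfold nsE
  rw [sum_pair (G := fun x y => (∏ j, nsW (Real.exp (-2 * t)) (x j, y j)) * (f x * f y))]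
  unfold bExp
  simp_rw [bP_eq, Finset.sum_mul_sum]
  rw [Finset.sum_comm, Finset.sum_div]
  refine Finset.sum_congr rfl fun y _ => ?_
  rw [Finset.sum_comm, Finset.sum_div]
  refine Finset.sum_congr rfl fun y' _ => ?_
  have h := Fintype.prod_sum (fun (i : Fin n) (b : Bool) =>
    (1 + Real.exp (-t) * bval (y i) * bval b) * (1 + Real.exp (-t) * bval (y' i) * bval b))
  have h2 : ∀ i : Fin n, ∑ b : Bool, (1 + Real.exp (-t) * bval (y i) * bval b) *
      (1 + Real.exp (-t) * bval (y' i) * bval b) = 8 * nsW (Real.exp (-2 * t)) (y i, y' i) := by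
    intro i
    have : Real.exp (-2 * t) = Real.exp (-t) * Real.exp (-t) := by
      rw [← Real.exp_add]; ring_nf
    rw [this, Fintype.sum_bool, bval_true, bval_false]; simp only [nsW]; ring
  simp_rw [h2, Finset.prod_mul_distrib] at h
  have h3 : ∀ x : Fin n → Bool, (f y / 2 ^ n * ∏ i, (1 + Real.exp (-t) * bval (y i) * bval (x i))) *
      (f y' / 2 ^ n * ∏ i, (1 + Real.exp (-t) * bval (y' i) * bval (x i))) =
      (f y / 2 ^ n) * (f y' / 2 ^ n) * ((∏ i, (1 + Real.exp (-t) * bval (y i) * bval (x i))) *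
       ∏ i, (1 + Real.exp (-t) * bval (y' i) * bval (x i))) := fun x => by ring
  simp_rw [h3]
  rw [← Finset.mul_sum, ← h]
  have : (∏ i : Fin n, (8:ℝ)) = 2 ^ n * 2 ^ n * 2 ^ n := by
    simp [← mul_pow]; norm_num
  rw [this]
  field_simp

lemma nsW_nonneg {ρ : ℝ} (h0 : 0 ≤ ρ) (h1 : ρ ≤ 1) (p : Bool × Bool) : 0 ≤ nsW ρ p := by
  rcases p with ⟨a, b⟩
  cases a <;> cases b <;> simp [nsW, bval] <;> linarith

lemma nsW_sum (ρ : ℝ) : ∑ p : Bool × Bool, nsW ρ p = 1 := by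
  rw [Fintype.sum_prod_type]
  simp [nsW, bval]; ring

lemma bExp_eq (n : ℕ) (ρ : ℝ) (f : (Fin n → Bool) → ℝ) :
    bExp n f = nsE ρ (fun z => f (fun i => (z i).1)) := by
  unfold nsE
  rw [sum_pair (G := fun x y => (∏ j, nsW ρ (x j, y j)) * f x)]
  unfold bExp
  rw [Finset.sum_div]
  refine Finset.sum_congr rfl fun x _ => ?_
  rw [← Finset.sum_mul, ← Fintype.prod_sum (fun (i : Fin n) (b : Bool) => nsW ρ (x i, b))]
  have : ∀ i : Fin n, ∑ b : Bool, nsW ρ (x i, b) = 1/2 := by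
    intro i; simp [nsW, bval]; ring
  simp only [this]
  simp; ring

lemma bVar_bP (n : ℕ) (t : ℝ) (f : (Fin n → Bool) → ℝ) :
    bVar n (bP n t f) =
      nsE (Real.exp (-2 * t)) (fun z => f (fun i => (z i).1) * f (fun i => (z i).2))
      - (nsE (Real.exp (-2 * t)) (fun z => f (fun i => (z i).1))) ^ 2 := by
  rw [← bExp_sq_bP, ← bExp_eq, ← bExp_bP n t f]
  unfold bVar bCov
  generalize bP n t f = g
  generalize hc : bExp n g = c
  unfold bExp at *
  have : ∀ x, (g x - c) * (g x - c) = g x * g x - 2 * c * g x + c ^ 2 := fun x => by ring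
  simp_rw [this]
  rw [Finset.sum_add_distrib, Finset.sum_sub_distrib, ← Finset.mul_sum]
  have h2 : ∑ x, g x = c * 2 ^ n := by rw [← hc]; field_simp
  rw [h2]
  simp
  field_simp
  ring


section
variable {ι : Type*} [Fintype ι] [DecidableEq ι] (ρ : ℝ)

lemma nsE_add (F G : (ι → Bool × Bool) → ℝ) :
    nsE ρ (fun z => F z + G z) = nsE ρ F + nsE ρ G := by
  simp [nsE, mul_add, Finset.sum_add_distrib]

lemma nsE_mul (c : ℝ) (F : (ι → Bool × Bool) → ℝ) :
    nsE ρ (fun z => c * F z) = c * nsE ρ F := by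
  simp only [nsE, Finset.mul_sum]
  exact Finset.sum_congr rfl fun z _ => by ring

lemma nsE_prod (g : ι → Bool × Bool → ℝ) :
    nsE ρ (fun z => ∏ j, g j (z j)) = ∏ j, ∑ p, nsW ρ p * g j p := by
  rw [Fintype.prod_sum, nsE]
  simp [Finset.prod_mul_distrib]

lemma nsE_const (c : ℝ) : nsE ρ (fun _ : ι → Bool × Bool => c) = c := by
  have h := nsE_prod (ι := ι) ρ (fun _ _ => 1)
  have h2 := nsE_mul ρ c (fun _ : ι → Bool × Bool => ∏ j : ι, (1 : ℝ))
  rw [h] at h2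
  simp only [mul_one, nsW_sum, Finset.prod_const_one] at h2
  exact h2

lemma nsE_mono (h0 : 0 ≤ ρ) (h1 : ρ ≤ 1) {F G : (ι → Bool × Bool) → ℝ} (h : ∀ z, F z ≤ G z) :
    nsE ρ F ≤ nsE ρ G :=
  Finset.sum_le_sum fun z _ => mul_le_mul_of_nonneg_left (h z)
    (Finset.prod_nonneg fun _ _ => nsW_nonneg h0 h1 _)
end

lemma nsE_succ (ρ : ℝ) (m : ℕ) (F : (Fin (m + 1) → Bool × Bool) → ℝ) :
    nsE ρ F = ∑ p, nsW ρ p * nsE ρ (fun z : Fin m → Bool × Bool => F (Fin.cons p z)) := by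
  unfold nsE
  rw [← (Fin.consEquiv (fun _ => Bool × Bool)).sum_comp, Fintype.sum_prod_type]
  refine Finset.sum_congr rfl fun p _ => ?_
  rw [Finset.mul_sum]
  refine Finset.sum_congr rfl fun z _ => ?_
  simp [Fin.consEquiv, Fin.prod_univ_succ, mul_assoc]

lemma one_step {ρ : ℝ} {α β : Bool × Bool → ℝ} {c : ℝ} (hα : ∑ p, nsW ρ p * α p = 0)
    (hβ : ∑ p, nsW ρ p * β p = 0) (hc : ∑ p, nsW ρ p * (α p * β p) = c) (K L M N : ℝ) :
    ∑ p, nsW ρ p * (K + α p * L + β p * M + α p * β p * N) = K + c * N := by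
  have : ∀ p, nsW ρ p * (K + α p * L + β p * M + α p * β p * N) =
    nsW ρ p * K + nsW ρ p * α p * L + nsW ρ p * β p * M + nsW ρ p * (α p * β p) * N :=
      fun p => by ring
  simp_rw [this, Finset.sum_add_distrib, ← Finset.sum_mul, hα, hβ, hc, nsW_sum]
  ring

lemma moments {ρ : ℝ} {α β : Bool × Bool → ℝ} {c : ℝ} (hα : ∑ p, nsW ρ p * α p = 0)
    (hβ : ∑ p, nsW ρ p * β p = 0) (hc : ∑ p, nsW ρ p * (α p * β p) = c)
    (hα2 : ∀ p, α p ^ 2 = 1) (hβ2 : ∀ p, β p ^ 2 = 1) (m : ℕ) :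
    nsE ρ (fun z : Fin m → Bool × Bool => (∑ j, α (z j)) ^ 2) = m ∧
    nsE ρ (fun z : Fin m → Bool × Bool => (∑ j, β (z j)) ^ 2) = m ∧
    nsE ρ (fun z : Fin m → Bool × Bool => (∑ j, α (z j)) * (∑ j, β (z j))) = c * m ∧
    nsE ρ (fun z : Fin m → Bool × Bool => (∑ j, α (z j)) ^ 2 * (∑ j, β (z j)) ^ 2) =
      m ^ 2 + 2 * c ^ 2 * m * (m - 1) := by
  induction m with
  | zero => simp [nsE]
  | succ m ih =>
    obtain ⟨h1, h2, h3, h4⟩ := ih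
    have os := one_step hα hβ hc
    simp_rw [nsE_succ, Fin.sum_univ_succ, Fin.cons_zero, Fin.cons_succ]
    set A : (Fin m → Bool × Bool) → ℝ := fun z => ∑ j, α (z j) with hA
    set B : (Fin m → Bool × Bool) → ℝ := fun z => ∑ j, β (z j) with hB
    refine ⟨?_, ?_, ?_, ?_⟩
    · have e : ∀ p, nsE ρ (fun z : Fin m → Bool × Bool => (α p + ∑ j, α (z j)) ^ 2) =
          (m + 1) + α p * (2 * nsE ρ A) + β p * 0 + α p * β p * 0 := by
        intro p
        have : (fun z : Fin m → Bool × Bool => (α p + ∑ j, α (z j)) ^ 2) =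
          fun z => A z ^ 2 + ((2 * α p) * A z + 1) := by
            funext z; simp only [hA]; linear_combination hα2 p
        rw [this, nsE_add, nsE_add, nsE_mul, nsE_const, h1]; ring
      simp_rw [e, os]; push_cast; ring
    · have e : ∀ p, nsE ρ (fun z : Fin m → Bool × Bool => (β p + ∑ j, β (z j)) ^ 2) =
          (m + 1) + α p * 0 + β p * (2 * nsE ρ B) + α p * β p * 0 := by
        intro p
        have : (fun z : Fin m → Bool × Bool => (β p + ∑ j, β (z j)) ^ 2) =
          fun z => B z ^ 2 + ((2 * β p) * B z + 1) := by
            funext z; simp only [hB]; linear_combination hβ2 p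
        rw [this, nsE_add, nsE_add, nsE_mul, nsE_const, h2]; ring
      simp_rw [e, os]; push_cast; ring
    · have e : ∀ p, nsE ρ (fun z : Fin m → Bool × Bool =>
            (α p + ∑ j, α (z j)) * (β p + ∑ j, β (z j))) =
          c * m + α p * nsE ρ B + β p * nsE ρ A + α p * β p * 1 := by
        intro p
        have : (fun z : Fin m → Bool × Bool => (α p + ∑ j, α (z j)) * (β p + ∑ j, β (z j))) =
          fun z => A z * B z + (α p * B z + (β p * A z + α p * β p)) := by
            funext z; simp only [hA, hB]; ring
        rw [this, nsE_add, nsE_add, nsE_add, nsE_mul, nsE_mul, nsE_const, h3]; ring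
      simp_rw [e, os]; push_cast; ring
    · have e : ∀ p, nsE ρ (fun z : Fin m → Bool × Bool =>
            (α p + ∑ j, α (z j)) ^ 2 * (β p + ∑ j, β (z j)) ^ 2) =
          (m ^ 2 + 2 * c ^ 2 * m * (m - 1) + 2 * m + 1)
            + α p * (2 * nsE ρ (fun z => A z * B z ^ 2) + 2 * nsE ρ A)
            + β p * (2 * nsE ρ (fun z => A z ^ 2 * B z) + 2 * nsE ρ B)
            + α p * β p * (4 * (c * m)) := by
        intro p
        have : (fun z : Fin m → Bool × Bool =>
            (α p + ∑ j, α (z j)) ^ 2 * (β p + ∑ j, β (z j)) ^ 2) =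
          fun z => A z ^ 2 * B z ^ 2 + (A z ^ 2 + (B z ^ 2 + (1 +
            ((2 * α p) * (A z * B z ^ 2) + ((2 * α p) * A z + ((2 * β p) * (A z ^ 2 * B z) +
             ((2 * β p) * B z + (4 * α p * β p) * (A z * B z)))))))) := by
            funext z
            have : (α p + ∑ j, α (z j)) ^ 2 = A z ^ 2 + 2 * α p * A z + 1 := by
              simp only [hA]; linear_combination hα2 p
            rw [this]
            have : (β p + ∑ j, β (z j)) ^ 2 = B z ^ 2 + 2 * β p * B z + 1 := by
              simp only [hB]; linear_combination hβ2 p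
            rw [this]
            ring
        rw [this]
        simp only [nsE_add, nsE_mul, nsE_const]
        rw [h1, h2, h3, h4]; ring
      simp_rw [e, os]; push_cast; ring

lemma sum_pairs (g : Bool × Bool → ℝ) :
    ∑ p, g p = g (true, true) + g (true, false) + g (false, true) + g (false, false) := by
  rw [Fintype.sum_prod_type]; simp; ring

/-- normalized block sums -/
noncomputable def blk (m : ℕ) (α : Bool × Bool → Bool) (z : Fin m → Bool × Bool) : ℝ :=
  (∑ j, bval (α (z j))) / Real.sqrt m

lemma blk_moments (ρ : ℝ) (m : ℕ) (hm : 0 < m) :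
    nsE ρ (fun z => blk m Prod.fst z ^ 2) = 1 ∧ nsE ρ (fun z => blk m Prod.snd z ^ 2) = 1 ∧
    nsE ρ (fun z => blk m Prod.fst z ^ 4) = 1 + 2 * (1 - 1 / m) ∧
    nsE ρ (fun z => blk m Prod.snd z ^ 4) = 1 + 2 * (1 - 1 / m) ∧
    nsE ρ (fun z => blk m Prod.fst z ^ 2 * blk m Prod.snd z ^ 2) =
      1 + 2 * ρ ^ 2 * (1 - 1 / m) := by
  have m0 : (m : ℝ) ≠ 0 := by positivity
  have s2 : ∀ (α) (z), blk m α z ^ 2 = (1 / m : ℝ) * (∑ j, bval (α (z j))) ^ 2 := by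
    intro α z; rw [blk, div_pow, Real.sq_sqrt (by positivity)]; ring
  have s4 : ∀ (α) (z), blk m α z ^ 4 =
      (1 / m : ℝ) ^ 2 * ((∑ j, bval (α (z j))) ^ 2 * (∑ j, bval (α (z j))) ^ 2) := by
    intro α z; rw [show blk m α z ^ 4 = (blk m α z ^ 2) ^ 2 by ring, s2]; ring
  have s22 : ∀ (z), blk m Prod.fst z ^ 2 * blk m Prod.snd z ^ 2 =
      (1 / m : ℝ) ^ 2 * ((∑ j, bval ((z j).1)) ^ 2 * (∑ j, bval ((z j).2)) ^ 2) := by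
    intro z; rw [s2, s2]; ring
  simp_rw [s4, s22, s2]
  have a0 : ∑ p, nsW ρ p * bval p.1 = 0 := by
    rw [sum_pairs]; simp only [nsW, bval_true, bval_false]; ring
  have b0 : ∑ p, nsW ρ p * bval p.2 = 0 := by
    rw [sum_pairs]; simp only [nsW, bval_true, bval_false]; ring
  have aa : ∑ p, nsW ρ p * (bval p.1 * bval p.1) = 1 := by
    rw [sum_pairs]; simp only [nsW, bval_true, bval_false]; ring
  have bb : ∑ p, nsW ρ p * (bval p.2 * bval p.2) = 1 := by
    rw [sum_pairs]; simp only [nsW, bval_true, bval_false]; ring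
  have ab : ∑ p, nsW ρ p * (bval p.1 * bval p.2) = ρ := by
    rw [sum_pairs]; simp only [nsW, bval_true, bval_false]; ring
  have M1 := moments a0 a0 aa (fun p => bval_sq _) (fun p => bval_sq _) m
  have M2 := moments b0 b0 bb (fun p => bval_sq _) (fun p => bval_sq _) m
  have M3 := moments a0 b0 ab (fun p => bval_sq _) (fun p => bval_sq _) m
  simp only [nsE_mul]
  rw [M1.1, M2.1, M1.2.2.2, M2.2.2.2, M3.2.2.2]
  refine ⟨?_, ?_, ?_, ?_, ?_⟩ <;> field_simp

lemma nsE_exp (ρ : ℝ) (m : ℕ) (l : ℝ) (α : Bool × Bool → Bool) :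
    nsE ρ (fun z : Fin m → Bool × Bool => Real.exp (l * ∑ j, bval (α (z j)))) =
      (∑ p, nsW ρ p * Real.exp (l * bval (α p))) ^ m := by
  simp_rw [Finset.mul_sum, Real.exp_sum]
  rw [nsE_prod ρ (fun _ p => Real.exp (l * bval (α p)))]
  simp

lemma pow6_le (x : ℝ) : x ^ 6 ≤ 720 * (Real.exp x + Real.exp (-x)) := by
  have h : ∀ y : ℝ, 0 ≤ y → y ^ 6 ≤ 720 * Real.exp y := by
    intro y hy
    have := Real.pow_div_factorial_le_exp y hy 6
    norm_num [Nat.factorial] at this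
    linarith
  rcases le_total 0 x with hx | hx
  · have := h x hx; have := Real.exp_pos (-x); linarith
  · have := h (-x) (by linarith); have := Real.exp_pos x
    have : (-x) ^ 6 = x ^ 6 := by ring
    linarith

lemma blk_six {ρ : ℝ} (h0 : 0 ≤ ρ) (h1 : ρ ≤ 1) (m : ℕ) (hm : 0 < m) :
    nsE ρ (fun z => blk m Prod.fst z ^ 6) ≤ 1440 * Real.exp (1 / 2) ∧
    nsE ρ (fun z => blk m Prod.snd z ^ 6) ≤ 1440 * Real.exp (1 / 2) := by
  have key : ∀ α : Bool × Bool → Bool,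
      (∀ l, ∑ p, nsW ρ p * Real.exp (l * bval (α p)) = Real.cosh l) →
      nsE ρ (fun z => blk m α z ^ 6) ≤ 1440 * Real.exp (1 / 2) := by
    intro α hα
    have hb : ∀ l : ℝ, l ^ 2 = 1 / m → nsE ρ (fun z : Fin m → Bool × Bool =>
        Real.exp (l * ∑ j, bval (α (z j)))) ≤ Real.exp (1 / 2) := by
      intro l hl
      rw [nsE_exp, hα]
      calc Real.cosh l ^ m ≤ Real.exp (l ^ 2 / 2) ^ m :=
            pow_le_pow_left₀ (Real.cosh_pos l).le (Real.cosh_le_exp_half_sq l) m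
        _ = Real.exp (1 / 2) := by
            rw [← Real.exp_nat_mul, hl]; congr 1; field_simp
    have s : (1 / Real.sqrt m) ^ 2 = 1 / m := by rw [div_pow, Real.sq_sqrt (by positivity)]; simp
    have e1 := hb (1 / Real.sqrt m) s
    have e2 := hb (-(1 / Real.sqrt m)) (by rw [neg_sq, s])
    calc nsE ρ (fun z => blk m α z ^ 6)
        ≤ nsE ρ (fun z => 720 * (Real.exp (1 / Real.sqrt m * ∑ j, bval (α (z j))) +
            Real.exp (-(1 / Real.sqrt m) * ∑ j, bval (α (z j))))) := by
          apply nsE_mono ρ h0 h1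
          intro z
          have := pow6_le (blk m α z)
          convert this using 4 <;> rw [blk] <;> ring_nf
      _ ≤ _ := by rw [nsE_mul, nsE_add]; linarith
  constructor <;> apply key <;> intro l <;> rw [sum_pairs] <;>
    simp only [nsW, bval_true, bval_false, Real.cosh_eq] <;> ring_nf


lemma taylor_exp (x : ℝ) :
    ‖Complex.exp (x * Complex.I) - (1 + x * Complex.I - (x : ℂ) ^ 2 / 2)‖ ≤ 4 * |x| ^ 3 := by
  rcases le_total |x| 1 with hx | hx
  · have hn : ‖(x : ℂ) * Complex.I‖ = |x| := by simp
    have := Complex.exp_bound (x := (x : ℂ) * Complex.I) (by rw [hn]; exact hx) (n := 3) (by norm_num)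
    rw [hn] at this
    simp only [Finset.sum_range_succ, Finset.range_zero, Finset.sum_empty, pow_zero, pow_one] at this
    norm_num [Nat.factorial] at this
    rw [mul_pow, Complex.I_sq] at this
    have e : (1 : ℂ) + x * Complex.I + (x : ℂ) ^ 2 * -1 / 2 = 1 + x * Complex.I - (x : ℂ) ^ 2 / 2 := by
      ring
    rw [e] at this
    have : 0 ≤ |x| ^ 3 := by positivity
    linarith
  · have h1 : ‖Complex.exp (x * Complex.I)‖ = 1 := Complex.norm_exp_ofReal_mul_I x
    have h2 : ‖(1 : ℂ) + x * Complex.I - (x : ℂ) ^ 2 / 2‖ ≤ 1 + |x| + |x| ^ 2 / 2 := by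
      refine (norm_sub_le _ _).trans ?_
      refine add_le_add ((norm_add_le _ _).trans ?_) ?_
      · simp
      · simp
    have := norm_sub_le (Complex.exp (x * Complex.I)) (1 + x * Complex.I - (x : ℂ) ^ 2 / 2)
    have a1 : |x| ≤ |x| ^ 3 := le_self_pow₀ hx (by norm_num)
    have a2 : |x| ^ 2 ≤ |x| ^ 3 := pow_le_pow_right₀ hx (by norm_num)
    linarith

/-- block variable -/
noncomputable def blkY (m : ℕ) (p q : ℝ) (z : Fin m → Bool × Bool) : ℝ :=
  p * (blk m Prod.fst z ^ 2 - 1) + q * (blk m Prod.snd z ^ 2 - 1)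

lemma blkY_mean (ρ : ℝ) (m : ℕ) (hm : 0 < m) (p q : ℝ) : nsE ρ (blkY m p q) = 0 := by
  obtain ⟨h1, h2, -, -, -⟩ := blk_moments ρ m hm
  have : blkY m p q = fun z => p * blk m Prod.fst z ^ 2 + (q * blk m Prod.snd z ^ 2 + (-(p + q))) := by
    funext z; rw [blkY]; ring
  rw [this, nsE_add, nsE_add, nsE_mul, nsE_mul, nsE_const, h1, h2]; ring

lemma blkY_var (ρ : ℝ) (m : ℕ) (hm : 0 < m) (p q : ℝ) :
    nsE ρ (fun z => blkY m p q z ^ 2) = 2 * (1 - 1 / m) * (p ^ 2 + q ^ 2 + 2 * p * q * ρ ^ 2) := by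
  obtain ⟨h1, h2, h3, h4, h5⟩ := blk_moments ρ m hm
  have : (fun z => blkY m p q z ^ 2) = fun z => p ^ 2 * blk m Prod.fst z ^ 4 +
      (q ^ 2 * blk m Prod.snd z ^ 4 + ((2 * p * q) * (blk m Prod.fst z ^ 2 * blk m Prod.snd z ^ 2) +
      ((-2 * p * (p + q)) * blk m Prod.fst z ^ 2 + ((-2 * q * (p + q)) * blk m Prod.snd z ^ 2 +
        (p + q) ^ 2)))) := by
    funext z; rw [blkY]; ring
  rw [this]
  simp only [nsE_add, nsE_mul, nsE_const]
  rw [h1, h2, h3, h4, h5]; ring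

lemma cube_bound {x y : ℝ} (hx : 0 ≤ x) (hy : 0 ≤ y) :
    (x + y + 1) ^ 3 ≤ 9 * (x ^ 3 + y ^ 3 + 1) := by
  nlinarith [mul_nonneg (add_nonneg hx hy) (sq_nonneg (x - y)),
    mul_nonneg (add_nonneg hx zero_le_one) (sq_nonneg (x - 1)),
    mul_nonneg (add_nonneg hy zero_le_one) (sq_nonneg (y - 1)),
    mul_nonneg hx (sq_nonneg (y - 1)), mul_nonneg hy (sq_nonneg (x - 1)),
    sq_nonneg (x - y), mul_nonneg hx (sq_nonneg (x - y)), mul_nonneg hx hy,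
    mul_nonneg hx (sq_nonneg (x - 1)), mul_nonneg hy (sq_nonneg (y - 1)), sq_nonneg (x-1), sq_nonneg (y-1)]

lemma blkY_third {ρ : ℝ} (h0 : 0 ≤ ρ) (h1 : ρ ≤ 1) (p q : ℝ) :
    ∃ C : ℝ, 0 ≤ C ∧ ∀ m : ℕ, 0 < m → nsE ρ (fun z => |blkY m p q z| ^ 3) ≤ C := by
  refine ⟨(|p| + |q|) ^ 3 * 9 * (1440 * Real.exp (1 / 2) + (1440 * Real.exp (1 / 2) + 1)),
    by positivity, fun m hm => ?_⟩
  obtain ⟨a, b⟩ := blk_six h0 h1 m hm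
  calc nsE ρ (fun z => |blkY m p q z| ^ 3)
      ≤ nsE ρ (fun z => ((|p| + |q|) ^ 3 * 9) *
          (blk m Prod.fst z ^ 6 + (blk m Prod.snd z ^ 6 + 1))) := by
        apply nsE_mono ρ h0 h1
        intro z
        set U := blk m Prod.fst z with hU
        set V := blk m Prod.snd z with hV
        have hY : |blkY m p q z| ≤ (|p| + |q|) * (U ^ 2 + V ^ 2 + 1) := by
          rw [blkY, ← hU, ← hV]
          refine (abs_add_le _ _).trans ?_
          rw [abs_mul, abs_mul, add_mul]
          have hu : |U ^ 2 - 1| ≤ U ^ 2 + V ^ 2 + 1 := by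
            rw [abs_le]; constructor <;> nlinarith [sq_nonneg U, sq_nonneg V]
          have hv : |V ^ 2 - 1| ≤ U ^ 2 + V ^ 2 + 1 := by
            rw [abs_le]; constructor <;> nlinarith [sq_nonneg U, sq_nonneg V]
          gcongr
        calc |blkY m p q z| ^ 3 ≤ ((|p| + |q|) * (U ^ 2 + V ^ 2 + 1)) ^ 3 := by gcongr
          _ = (|p| + |q|) ^ 3 * (U ^ 2 + V ^ 2 + 1) ^ 3 := by ring
          _ ≤ (|p| + |q|) ^ 3 * (9 * ((U ^ 2) ^ 3 + (V ^ 2) ^ 3 + 1)) := by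
              gcongr; exact cube_bound (sq_nonneg U) (sq_nonneg V)
          _ = _ := by ring
    _ ≤ _ := by
        rw [nsE_mul, nsE_add, nsE_add, nsE_const]
        gcongr

/-- block characteristic function -/
noncomputable def blkPhi (ρ : ℝ) (m : ℕ) (p q : ℝ) : ℂ :=
  ∑ z : Fin m → Bool × Bool, ((∏ j, nsW ρ (z j) : ℝ) : ℂ) *
    Complex.exp ((blkY m p q z / Real.sqrt m : ℝ) * Complex.I)

lemma blkPhi_bound {ρ : ℝ} (h0 : 0 ≤ ρ) (h1 : ρ ≤ 1) (p q : ℝ) :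
    ∃ C : ℝ, 0 ≤ C ∧ ∀ m : ℕ, 0 < m →
      ‖blkPhi ρ m p q - (1 - (((1 - 1 / m) * (p ^ 2 + q ^ 2 + 2 * p * q * ρ ^ 2) / m : ℝ) : ℂ))‖
        ≤ C / (m * Real.sqrt m) := by
  obtain ⟨C, hC, hb⟩ := blkY_third h0 h1 p q
  refine ⟨4 * C, by positivity, fun m hm => ?_⟩
  have sm : 0 < Real.sqrt m := Real.sqrt_pos.2 (by exact_mod_cast hm)
  have sm2 : Real.sqrt m ^ 2 = m := Real.sq_sqrt (by positivity)
  have eqn : (1 - (((1 - 1 / m) * (p ^ 2 + q ^ 2 + 2 * p * q * ρ ^ 2) / m : ℝ) : ℂ)) =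
      ∑ z : Fin m → Bool × Bool, ((∏ j, nsW ρ (z j) : ℝ) : ℂ) *
        (1 + ((blkY m p q z / Real.sqrt m : ℝ) : ℂ) * Complex.I
          - ((blkY m p q z / Real.sqrt m : ℝ) : ℂ) ^ 2 / 2) := by
    have e : ∀ z : Fin m → Bool × Bool, ((∏ j, nsW ρ (z j) : ℝ) : ℂ) *
        (1 + ((blkY m p q z / Real.sqrt m : ℝ) : ℂ) * Complex.I
          - ((blkY m p q z / Real.sqrt m : ℝ) : ℂ) ^ 2 / 2) =
        (((∏ j, nsW ρ (z j)) * 1 : ℝ) : ℂ)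
         + (((∏ j, nsW ρ (z j)) * blkY m p q z : ℝ) : ℂ) * (Complex.I / (Real.sqrt m : ℂ))
         - (((∏ j, nsW ρ (z j)) * blkY m p q z ^ 2 : ℝ) : ℂ) * (1 / (2 * (m : ℂ))) := by
      intro z
      have : (m : ℂ) = (Real.sqrt m : ℂ) ^ 2 := by exact_mod_cast sm2.symm
      rw [this]; push_cast
      have : (Real.sqrt m : ℂ) ≠ 0 := by exact_mod_cast sm.ne'
      field_simp
    simp_rw [e]
    rw [Finset.sum_sub_distrib, Finset.sum_add_distrib, ← Finset.sum_mul, ← Finset.sum_mul,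
      ← Complex.ofReal_sum, ← Complex.ofReal_sum, ← Complex.ofReal_sum]
    have c1 := nsE_const (ι := Fin m) ρ 1
    have c2 := blkY_mean ρ m hm p q
    have c3 := blkY_var ρ m hm p q
    unfold nsE at c1 c2 c3
    rw [c1, c2, c3]
    have : (m : ℂ) ≠ 0 := by exact_mod_cast hm.ne'
    push_cast
    field_simp
    simp
  rw [eqn, blkPhi, ← Finset.sum_sub_distrib]
  refine (norm_sum_le _ _).trans ?_
  have : ∀ z : Fin m → Bool × Bool, ‖((∏ j, nsW ρ (z j) : ℝ) : ℂ) *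
    Complex.exp ((blkY m p q z / Real.sqrt m : ℝ) * Complex.I) - ((∏ j, nsW ρ (z j) : ℝ) : ℂ) *
        (1 + ((blkY m p q z / Real.sqrt m : ℝ) : ℂ) * Complex.I
          - ((blkY m p q z / Real.sqrt m : ℝ) : ℂ) ^ 2 / 2)‖ ≤
        (∏ j, nsW ρ (z j)) * ((4 / (m * Real.sqrt m)) * |blkY m p q z| ^ 3) := by
    intro z
    have w0 : 0 ≤ ∏ j, nsW ρ (z j) := Finset.prod_nonneg fun _ _ => nsW_nonneg h0 h1 _
    rw [← mul_sub, norm_mul, Complex.norm_real, Real.norm_of_nonneg w0]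
    refine mul_le_mul_of_nonneg_left ((taylor_exp _).trans (le_of_eq ?_)) w0
    rw [abs_div, abs_of_pos sm, div_pow, show Real.sqrt m ^ 3 = m * Real.sqrt m by
      rw [pow_succ, sm2]]
    ring
  refine (Finset.sum_le_sum fun z _ => this z).trans ?_
  have h := nsE_mul ρ (4 / (m * Real.sqrt m)) (fun z => |blkY m p q z| ^ 3)
  rw [nsE] at h
  rw [h]
  calc 4 / (m * Real.sqrt m) * nsE ρ (fun z => |blkY m p q z| ^ 3)
      ≤ 4 / (m * Real.sqrt m) * C := by gcongr; exact hb m hm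
    _ = _ := by ring

open Filter Topology in
lemma blkPhi_tendsto {ρ : ℝ} (h0 : 0 ≤ ρ) (h1 : ρ ≤ 1) (p q : ℝ) :
    Tendsto (fun m : ℕ => blkPhi ρ m p q ^ m) atTop
      (𝓝 (Complex.exp (-(p ^ 2 + q ^ 2 + 2 * p * q * ρ ^ 2 : ℝ)))) := by
  obtain ⟨C, hC, hb⟩ := blkPhi_bound h0 h1 p q
  set s := p ^ 2 + q ^ 2 + 2 * p * q * ρ ^ 2 with hs
  apply Complex.tendsto_pow_exp_of_isLittleO_sub_add_div
  rw [Asymptotics.isLittleO_iff]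
  intro c hc
  have t1 : Tendsto (fun m : ℕ => C / Real.sqrt m + |s| / m) atTop (𝓝 (0 + 0)) := by
    refine Tendsto.add ?_ ?_
    · exact tendsto_const_nhds.div_atTop (Real.tendsto_sqrt_atTop.comp tendsto_natCast_atTop_atTop)
    · exact tendsto_const_nhds.div_atTop tendsto_natCast_atTop_atTop
  rw [add_zero] at t1
  filter_upwards [t1.eventually (gt_mem_nhds hc), eventually_gt_atTop 0] with m hm hm0
  have mp : (0 : ℝ) < m := by exact_mod_cast hm0
  have e : blkPhi ρ m p q - (1 + -(s : ℂ) / m) =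
     (blkPhi ρ m p q - (1 - (((1 - 1 / m) * s / m : ℝ) : ℂ))) + ((s / m / m : ℝ) : ℂ) := by
    have : (m : ℂ) ≠ 0 := by exact_mod_cast hm0.ne'
    push_cast; field_simp; ring
  push_cast at e ⊢
  rw [e]
  refine (norm_add_le _ _).trans ?_
  have h2 := hb m hm0
  push_cast at h2
  have h3 : ‖(s : ℂ) / m / m‖ = |s| / m / m := by simp
  rw [h3]
  have h4 : ‖(1 / m : ℂ)‖ = 1 / m := by simp
  rw [h4]
  calc _ ≤ C / (m * Real.sqrt m) + |s| / m / m := by gcongr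
    _ = (C / Real.sqrt m + |s| / m) * (1 / m) := by ring
    _ ≤ c * (1 / m) := by gcongr


open MeasureTheory ProbabilityTheory in
/-- planar standard Gaussian -/
noncomputable def gR : Measure (ℝ × ℝ) := (gaussianReal 0 1).prod (gaussianReal 0 1)

open MeasureTheory ProbabilityTheory in
/-- planar standard Gaussian on `ℂ` -/
noncomputable def gC : Measure ℂ := gR.map Complex.measurableEquivRealProd.symm

open MeasureTheory ProbabilityTheory in
instance gR_prob : IsProbabilityMeasure gR := by unfold gR; infer_instance

open MeasureTheory ProbabilityTheory in
instance gC_prob : IsProbabilityMeasure gC := by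
  unfold gC
  exact Measure.isProbabilityMeasure_map (Complex.measurableEquivRealProd.symm.measurable.aemeasurable)

open MeasureTheory ProbabilityTheory in
lemma charFun_gC (w : ℂ) : charFun gC w = Complex.exp (-(w.re ^ 2 + w.im ^ 2 : ℝ) / 2) := by
  rw [charFun_apply, gC, integral_map_equiv, gR]
  have e : ∀ x : ℝ × ℝ, Complex.exp ((inner ℝ (Complex.measurableEquivRealProd.symm x) w : ℝ) * Complex.I)
      = Complex.exp (w.re * x.1 * Complex.I) * Complex.exp (w.im * x.2 * Complex.I) := by
    intro x
    rw [← Complex.exp_add]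
    congr 1
    simp [Complex.inner, Complex.measurableEquivRealProd_symm_apply]
    ring
  simp_rw [e]
  rw [integral_prod_mul (f := fun x : ℝ => Complex.exp (w.re * x * Complex.I))
    (g := fun x : ℝ => Complex.exp (w.im * x * Complex.I)), ← charFun_apply_real, ← charFun_apply_real,
    charFun_gaussianReal, charFun_gaussianReal, ← Complex.exp_add]
  congr 1
  push_cast
  ring

open MeasureTheory ProbabilityTheory in
lemma gR_density : gR = (volume : Measure (ℝ × ℝ)).withDensity
    (fun p => ENNReal.ofReal (Real.exp (-(p.1 ^ 2 + p.2 ^ 2) / 2) / (2 * π))) := by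
  rw [gR, gaussianReal_of_var_ne_zero _ one_ne_zero,
    prod_withDensity (measurable_gaussianPDF _ _) (measurable_gaussianPDF _ _)]
  congr 1
  funext p
  rw [gaussianPDF, gaussianPDF, ← ENNReal.ofReal_mul (gaussianPDFReal_nonneg _ _ _)]
  congr 1
  simp only [gaussianPDFReal, NNReal.coe_one, mul_one, sub_zero]
  have h : (Real.sqrt (2 * π))⁻¹ * (Real.sqrt (2 * π))⁻¹ = (2 * π)⁻¹ := by
    rw [← mul_inv, Real.mul_self_sqrt (by positivity)]
  rw [show ∀ a b c : ℝ, a * b * (a * c) = a * a * (b * c) from fun a b c => by ring, h,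
    ← Real.exp_add]
  rw [div_eq_mul_inv _ (2 * π), mul_comm]
  congr 2
  ring

/-- radial mass -/
noncomputable def gK : ENNReal :=
  MeasureTheory.lintegral (MeasureTheory.volume.restrict (Set.Ioi (0 : ℝ)))
    (fun r => ENNReal.ofReal r * ENNReal.ofReal (Real.exp (-r ^ 2 / 2) / (2 * π)))

open MeasureTheory ProbabilityTheory in
lemma gR_cone (C : Set (ℝ × ℝ)) (hC : MeasurableSet C)
    (hcone : ∀ r : ℝ, 0 < r → ∀ x y : ℝ, (r * x, r * y) ∈ C ↔ (x, y) ∈ C) :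
    gR C = gK * volume {θ : ℝ | θ ∈ Set.Ioo (-π) π ∧ (Real.cos θ, Real.sin θ) ∈ C} := by
  have hA : MeasurableSet {θ : ℝ | θ ∈ Set.Ioo (-π) π ∧ (Real.cos θ, Real.sin θ) ∈ C} := by
    refine measurableSet_Ioo.inter ?_
    exact (by fun_prop : Measurable fun θ : ℝ => (Real.cos θ, Real.sin θ)) hC
  rw [gR_density, withDensity_apply _ hC, ← lintegral_indicator hC,
    ← lintegral_comp_polarCoord_symm, ← lintegral_indicator (polarCoord.open_target.measurableSet)]
  have e : ∀ p : ℝ × ℝ, (polarCoord.target.indicator (fun p : ℝ × ℝ => ENNReal.ofReal p.1 •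
      C.indicator (fun p => ENNReal.ofReal (Real.exp (-(p.1 ^ 2 + p.2 ^ 2) / 2) / (2 * π)))
        (polarCoord.symm p))) p =
      ((Set.Ioi (0 : ℝ)).indicator (fun r => ENNReal.ofReal r *
          ENNReal.ofReal (Real.exp (-r ^ 2 / 2) / (2 * π))) p.1) *
       ({θ : ℝ | θ ∈ Set.Ioo (-π) π ∧ (Real.cos θ, Real.sin θ) ∈ C}.indicator 1 p.2) := by
    rintro ⟨r, θ⟩
    by_cases hr : 0 < r
    · by_cases hθ : θ ∈ Set.Ioo (-π) π
      · have hm : (r, θ) ∈ polarCoord.target := ⟨hr, hθ⟩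
        rw [Set.indicator_of_mem hm, Set.indicator_of_mem (show r ∈ Set.Ioi (0 : ℝ) from hr)]
        simp only [polarCoord_symm_apply]
        by_cases hc : (Real.cos θ, Real.sin θ) ∈ C
        · rw [Set.indicator_of_mem ((hcone r hr _ _).2 hc), Set.indicator_of_mem
            (show θ ∈ {θ : ℝ | θ ∈ Set.Ioo (-π) π ∧ (Real.cos θ, Real.sin θ) ∈ C} from ⟨hθ, hc⟩)]
          have : (r * Real.cos θ) ^ 2 + (r * Real.sin θ) ^ 2 = r ^ 2 := by
            linear_combination r ^ 2 * Real.cos_sq_add_sin_sq θ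
          simp [this]
        · rw [Set.indicator_of_notMem (fun h => hc ((hcone r hr _ _).1 h)),
            Set.indicator_of_notMem (fun h => hc h.2)]
          simp
      · rw [Set.indicator_of_notMem (fun h => hθ h.2), Set.indicator_of_notMem (s := {θ : ℝ | _})
          (fun h => hθ h.1)]
        simp
    · rw [Set.indicator_of_notMem (fun h => hr h.1), Set.indicator_of_notMem (s := Set.Ioi (0 : ℝ))
        (fun h => hr h)]
      simp
  rw [lintegral_congr e, Measure.volume_eq_prod, lintegral_prod_mul]
  · rw [lintegral_indicator measurableSet_Ioi, lintegral_indicator_one hA]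
    rfl
  · exact (Measurable.indicator (by fun_prop) measurableSet_Ioi).aemeasurable
  · exact (measurable_one.indicator hA).aemeasurable

open MeasureTheory in
lemma gK_eq : gK = ENNReal.ofReal (1 / (2 * π)) := by
  have h := gR_cone Set.univ MeasurableSet.univ (by simp)
  simp only [measure_univ, Set.mem_univ, and_true] at h
  rw [show {θ : ℝ | θ ∈ Set.Ioo (-π) π} = Set.Ioo (-π) π from rfl, Real.volume_Ioo] at h
  have hp : 0 < 2 * π := by positivity
  rw [one_div, ENNReal.ofReal_inv_of_pos hp]
  rw [show π - -π = 2 * π by ring] at h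
  exact ENNReal.eq_inv_of_mul_eq_one_left h.symm

open MeasureTheory in
lemma gC_cone_le (C : Set ℂ) (hC : MeasurableSet C)
    (hcone : ∀ r : ℝ, 0 < r → ∀ z : ℂ, (r : ℂ) * z ∈ C ↔ z ∈ C) (A : Set ℝ) (b : ℝ)
    (hA : ∀ θ ∈ Set.Ioo (-π) π, (⟨Real.cos θ, Real.sin θ⟩ : ℂ) ∈ C → θ ∈ A)
    (hb : volume A ≤ ENNReal.ofReal b) :
    gC C ≤ ENNReal.ofReal (b / (2 * π)) := by
  have hp : 0 < 2 * π := by positivity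
  rw [gC, Measure.map_apply (Complex.measurableEquivRealProd.symm.measurable) hC, gR_cone]
  · rw [gK_eq]
    calc _ ≤ ENNReal.ofReal (1 / (2 * π)) * ENNReal.ofReal b := by
            gcongr
            refine (measure_mono ?_).trans hb
            rintro θ ⟨h1, h2⟩
            exact hA θ h1 h2
      _ = _ := by rw [← ENNReal.ofReal_mul (by positivity)]; congr 1; ring
  · exact Complex.measurableEquivRealProd.symm.measurable hC
  · intro r hr x y
    have := hcone r hr ⟨x, y⟩
    simp only [Set.mem_preimage, Complex.measurableEquivRealProd_symm_apply]
    convert this using 2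
    apply Complex.ext <;> simp

open MeasureTheory in
lemma gC_right : gC {z | 0 ≤ z.re} ≤ ENNReal.ofReal (1 / 2) := by
  have := gC_cone_le {z | 0 ≤ z.re} (measurableSet_le measurable_const Complex.measurable_re)
    (by intro r hr z; simp [hr]) (Set.Icc (-(π / 2)) (π / 2)) π ?_ ?_
  · convert this using 2; field_simp
  · intro θ hθ hc
    simp only [Set.mem_ofPred_eq] at hc
    constructor
    · by_contra! h
      have := Real.cos_neg_of_pi_div_two_lt_of_lt (x := -θ) (by linarith) (by linarith [hθ.1])
      rw [Real.cos_neg] at this; linarith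
    · by_contra! h
      have := Real.cos_neg_of_pi_div_two_lt_of_lt h (by linarith [hθ.2])
      linarith
  · rw [Real.volume_Icc]; apply le_of_eq; congr 1; ring

open MeasureTheory in
lemma gC_left : gC {z | z.re ≤ 0} ≤ ENNReal.ofReal (1 / 2) := by
  have := gC_cone_le {z | z.re ≤ 0} (measurableSet_le Complex.measurable_re measurable_const)
    (by intro r hr z; simp [mul_nonpos_iff, hr.le, hr.not_ge])
    (Set.Icc (-π) (-(π / 2)) ∪ Set.Icc (π / 2) π) π ?_ ?_
  · convert this using 2; field_simp
  · intro θ hθ hc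
    simp only [Set.mem_ofPred_eq] at hc
    by_contra h
    simp only [Set.mem_union, Set.mem_Icc, not_or, not_and_or, not_le] at h
    have h1 : -(π / 2) < θ := by rcases h.1 with h | h <;> linarith [hθ.1]
    have h2 : θ < π / 2 := by rcases h.2 with h | h <;> linarith [hθ.2]
    have := Real.cos_pos_of_mem_Ioo ⟨h1, h2⟩
    linarith
  · refine (measure_union_le _ _).trans ?_
    rw [Real.volume_Icc, Real.volume_Icc, ← ENNReal.ofReal_add] <;> try linarith [Real.pi_pos]
    apply le_of_eq; congr 1; ring

open MeasureTheory in
lemma gC_sector {r s : ℝ} (hr0 : 0 < r) (hr : r < 1) (hs : s = Real.sqrt (1 - r ^ 2)) :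
    gC {z | 0 ≤ z.re ∧ 0 ≤ -r * z.re + s * z.im} ≤ ENNReal.ofReal (Real.arccos r / (2 * π)) := by
  refine gC_cone_le _ ?_ ?_ (Set.Icc (Real.arcsin r) (π / 2)) _ ?_ ?_
  · exact (measurableSet_le measurable_const Complex.measurable_re).inter
      (measurableSet_le measurable_const ((Complex.measurable_re.const_mul _).add
        (Complex.measurable_im.const_mul _)))
  · intro c hc z
    simp only [Set.mem_ofPred_eq, Complex.re_ofReal_mul, Complex.im_ofReal_mul]
    rw [show -r * (c * z.re) + s * (c * z.im) = c * (-r * z.re + s * z.im) by ring]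
    simp [hc]
  · intro θ hθ hc
    simp only [Set.mem_ofPred_eq] at hc
    obtain ⟨h1, h2⟩ := hc
    have e : -r * Real.cos θ + s * Real.sin θ = Real.sin (θ - Real.arcsin r) := by
      rw [Real.sin_sub, Real.sin_arcsin (by linarith) hr.le, Real.cos_arcsin, hs]; ring
    rw [e] at h2
    have u1 : -(π / 2) ≤ θ := by
      by_contra! h
      have := Real.cos_neg_of_pi_div_two_lt_of_lt (x := -θ) (by linarith) (by linarith [hθ.1])
      rw [Real.cos_neg] at this; linarith
    have u2 : θ ≤ π / 2 := by
      by_contra! h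
      have := Real.cos_neg_of_pi_div_two_lt_of_lt h (by linarith [hθ.2])
      linarith
    refine ⟨?_, u2⟩
    by_contra! h
    have b2 : Real.arcsin r < π / 2 := Real.arcsin_lt_pi_div_two.2 hr
    have := Real.sin_neg_of_neg_of_neg_pi_lt (x := θ - Real.arcsin r) (by linarith) (by linarith)
    linarith
  · rw [Real.volume_Icc, Real.arccos]

lemma arccos_ineq {ρ : ℝ} (h0 : 0 < ρ) (h1 : ρ < 1) :
    Real.arccos (ρ ^ 2) ≤ Real.sqrt 2 * Real.arccos ρ := by
  set θ := Real.arccos ρ with hθ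
  have hc : Real.cos θ = ρ := Real.cos_arccos (by linarith) h1.le
  have t0 : 0 ≤ θ := Real.arccos_nonneg _
  have t1 : θ ≤ π / 2 := Real.arccos_le_pi_div_two.2 h0.le
  have s2 : Real.sqrt 2 ^ 2 = 2 := Real.sq_sqrt (by norm_num)
  have s0 : 0 ≤ Real.sqrt 2 := Real.sqrt_nonneg 2
  have s3 : Real.sqrt 2 ≤ 2 := by nlinarith
  have b1 : Real.sqrt 2 * θ ≤ π := by nlinarith [Real.pi_pos]
  have key : Real.cos (Real.sqrt 2 * θ) ≤ ρ ^ 2 := by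
    let g : ℝ → ℝ := fun x => Real.cos x ^ 2 - Real.cos (Real.sqrt 2 * x)
    have hd : ∀ x, HasDerivAt g (Real.sqrt 2 * Real.sin (Real.sqrt 2 * x) - Real.sin (2 * x)) x := by
      intro x
      have d1 := (Real.hasDerivAt_cos x).pow 2
      have d2 := ((hasDerivAt_id x).const_mul (Real.sqrt 2)).cos
      have d3 := d1.sub d2
      refine d3.congr_deriv ?_
      rw [Real.sin_two_mul]; simp; ring
    have hmono : MonotoneOn g (Set.Icc 0 (π / 2)) := by
      apply monotoneOn_of_deriv_nonneg (convex_Icc _ _)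
        (fun x _ => (hd x).continuousAt.continuousWithinAt)
        (fun x _ => (hd x).differentiableAt.differentiableWithinAt)
      intro x hx
      rw [interior_Icc] at hx
      rw [(hd x).deriv]
      have cc := strictConcaveOn_sin_Icc.concaveOn.2
        (show (0 : ℝ) ∈ Set.Icc 0 π from ⟨le_rfl, Real.pi_pos.le⟩)
        (show 2 * x ∈ Set.Icc 0 π from ⟨by linarith [hx.1], by linarith [hx.2]⟩)
        (show 0 ≤ 1 - Real.sqrt 2 / 2 by linarith) (show 0 ≤ Real.sqrt 2 / 2 by positivity)
        (by ring)
      simp only [smul_eq_mul, Real.sin_zero, mul_zero, zero_add] at cc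
      rw [show Real.sqrt 2 / 2 * (2 * x) = Real.sqrt 2 * x by ring] at cc
      have := mul_le_mul_of_nonneg_left cc s0
      have e : Real.sqrt 2 * (Real.sqrt 2 / 2 * Real.sin (2 * x)) = Real.sin (2 * x) := by
        linear_combination (Real.sin (2 * x) / 2) * s2
      linarith
    have := hmono (show (0 : ℝ) ∈ Set.Icc 0 (π / 2) from ⟨le_rfl, by positivity⟩)
      (show θ ∈ Set.Icc 0 (π / 2) from ⟨t0, t1⟩) t0
    simp only [g, hc, Real.cos_zero, mul_zero] at this
    linarith
  have := Real.arccos_le_arccos key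
  rwa [Real.arccos_cos (by positivity) b1] at this


/-- weight of a block configuration -/
noncomputable def bW (ρ : ℝ) (m : ℕ) (z : Fin m → Fin m → Bool × Bool) : ℝ :=
  ∏ i, ∏ j, nsW ρ (z i j)

/-- expectation over block configurations -/
noncomputable def bE (ρ : ℝ) (m : ℕ) (F : (Fin m → Fin m → Bool × Bool) → ℝ) : ℝ :=
  ∑ z, bW ρ m z * F z

/-- flatten blocks -/
def flat {m : ℕ} (z : Fin m → Fin m → Bool × Bool) (k : Fin (m * m)) : Bool × Bool :=
  z (finProdFinEquiv.symm k).1 (finProdFinEquiv.symm k).2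

lemma nsE_flat (ρ : ℝ) (m : ℕ) (F : (Fin (m * m) → Bool × Bool) → ℝ) :
    nsE ρ F = bE ρ m (fun z => F (flat z)) := by
  unfold nsE bE bW
  symm
  refine Fintype.sum_equiv ((Equiv.curry (Fin m) (Fin m) (Bool × Bool)).symm.trans
    (Equiv.arrowCongr finProdFinEquiv (Equiv.refl _))) _ _ ?_
  intro z
  have : (((Equiv.curry (Fin m) (Fin m) (Bool × Bool)).symm.trans
    (Equiv.arrowCongr finProdFinEquiv (Equiv.refl _))) z) = flat z := by
    funext k; rfl
  rw [this]
  congr 1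
  rw [← finProdFinEquiv.prod_comp, Fintype.prod_prod_type]
  simp [flat]

/-- normalized statistic -/
noncomputable def bX (m : ℕ) (α : Bool × Bool → Bool) (z : Fin m → Fin m → Bool × Bool) : ℝ :=
  ∑ i, (blk m α (z i) ^ 2 - 1) / Real.sqrt m

lemma mem_Bm (m : ℕ) (hm : 0 < m) (α : Bool × Bool → Bool) (z : Fin m → Fin m → Bool × Bool) :
    (fun k => α (flat z k)) ∈ Bm m ↔ bX m α z ≤ 0 := by
  have h : ∀ i : Fin m, (∑ k : Fin (m * m), if (k : ℕ) / m = (i : ℕ) then bval (α (flat z k)) else 0)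
      = ∑ j, bval (α (z i j)) := by
    intro i
    rw [← finProdFinEquiv.sum_comp, Fintype.sum_prod_type]
    have : ∀ i' j : Fin m, ((finProdFinEquiv (i', j) : Fin (m * m)) : ℕ) / m = (i' : ℕ) := by
      intro i' j
      rw [finProdFinEquiv_apply_val, Nat.add_mul_div_left _ _ hm, Nat.div_eq_of_lt j.2, zero_add]
    simp_rw [this, flat, Equiv.symm_apply_apply, Fin.val_inj]
    rw [Finset.sum_eq_single i]
    · simp
    · intro b _ hb; simp [hb]
    · simp
  have sm : 0 < Real.sqrt m := Real.sqrt_pos.2 (by exact_mod_cast hm)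
  have : (fun k => α (flat z k)) ∈ Bm m ↔ ∑ i, blk m α (z i) ^ 2 ≤ m := by
    unfold Bm blk
    simp only [Set.mem_ofPred_eq, h]
  rw [this, bX, ← Finset.sum_div, Finset.sum_sub_distrib]
  simp only [Finset.sum_const, Finset.card_univ, Fintype.card_fin, nsmul_eq_mul, mul_one]
  rw [div_le_iff₀ sm, zero_mul, sub_nonpos]

/-- point in the plane attached to a configuration -/
noncomputable def bpt (m : ℕ) (r s : ℝ) (z : Fin m → Fin m → Bool × Bool) : ℂ :=
  ⟨-bX m Prod.fst z / Real.sqrt 2, (bX m Prod.snd z - r * bX m Prod.fst z) / (Real.sqrt 2 * s)⟩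

open MeasureTheory in
/-- law in the plane -/
noncomputable def bMu (ρ : ℝ) (m : ℕ) (r s : ℝ) : Measure ℂ :=
  ∑ z, ENNReal.ofReal (bW ρ m z) • Measure.dirac (bpt m r s z)

lemma bW_nonneg {ρ : ℝ} (h0 : 0 ≤ ρ) (h1 : ρ ≤ 1) (m : ℕ) (z) : 0 ≤ bW ρ m z :=
  Finset.prod_nonneg fun _ _ => Finset.prod_nonneg fun _ _ => nsW_nonneg h0 h1 _

lemma bE_const (ρ : ℝ) (m : ℕ) (c : ℝ) : bE ρ m (fun _ => c) = c := by
  rw [← nsE_flat ρ m (fun _ => c), nsE_const]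

lemma bE_mono {ρ : ℝ} (h0 : 0 ≤ ρ) (h1 : ρ ≤ 1) {m : ℕ} {F G : (Fin m → Fin m → Bool × Bool) → ℝ}
    (h : ∀ z, F z ≤ G z) : bE ρ m F ≤ bE ρ m G :=
  Finset.sum_le_sum fun z _ => mul_le_mul_of_nonneg_left (h z) (bW_nonneg h0 h1 m z)

lemma bE_add (ρ : ℝ) (m : ℕ) (F G : (Fin m → Fin m → Bool × Bool) → ℝ) :
    bE ρ m (fun z => F z + G z) = bE ρ m F + bE ρ m G := by
  simp [bE, mul_add, Finset.sum_add_distrib]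

open MeasureTheory in
lemma bMu_apply {ρ : ℝ} (h0 : 0 ≤ ρ) (h1 : ρ ≤ 1) (m : ℕ) (r s : ℝ) (C : Set ℂ)
    (hC : MeasurableSet C) :
    bMu ρ m r s C = ENNReal.ofReal (bE ρ m (fun z => C.indicator 1 (bpt m r s z))) := by
  rw [bMu, Measure.finsetSum_apply, bE, ENNReal.ofReal_sum_of_nonneg]
  · refine Finset.sum_congr rfl fun z _ => ?_
    rw [Measure.smul_apply, Measure.dirac_apply' _ hC, smul_eq_mul,
      ENNReal.ofReal_mul (bW_nonneg h0 h1 m z)]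
    congr 1
    by_cases h : bpt m r s z ∈ C <;> simp [h]
  · intro z _
    exact mul_nonneg (bW_nonneg h0 h1 m z) (Set.indicator_nonneg (by simp) _)

open MeasureTheory in
lemma bMu_prob {ρ : ℝ} (h0 : 0 ≤ ρ) (h1 : ρ ≤ 1) (m : ℕ) (r s : ℝ) :
    IsProbabilityMeasure (bMu ρ m r s) := by
  constructor
  rw [bMu_apply h0 h1 m r s _ MeasurableSet.univ]
  simp [bE_const]

open MeasureTheory in
lemma charFun_bMu {ρ : ℝ} (h0 : 0 ≤ ρ) (h1 : ρ ≤ 1) (m : ℕ) (r s : ℝ) (hs : s ≠ 0) (w : ℂ) :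
    charFun (bMu ρ m r s) w =
      blkPhi ρ m ((-w.re - w.im * r / s) / Real.sqrt 2) (w.im / (s * Real.sqrt 2)) ^ m := by
  set p := (-w.re - w.im * r / s) / Real.sqrt 2 with hp
  set q := w.im / (s * Real.sqrt 2) with hq
  have hi : ∀ z, (inner ℝ (bpt m r s z) w : ℝ) = ∑ i, blkY m p q (z i) / Real.sqrt m := by
    intro z
    have e1 : ∑ i, blkY m p q (z i) / Real.sqrt m = p * bX m Prod.fst z + q * bX m Prod.snd z := by
      simp only [bX, Finset.mul_sum, ← Finset.sum_add_distrib, blkY]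
      exact Finset.sum_congr rfl fun i _ => by ring
    rw [e1]
    have : Real.sqrt 2 ≠ 0 := by positivity
    simp [Complex.inner, bpt, hp, hq]
    field_simp
    ring
  have : charFun (bMu ρ m r s) w = ∑ z, ((bW ρ m z : ℝ) : ℂ) *
      Complex.exp ((inner ℝ (bpt m r s z) w : ℝ) * Complex.I) := by
    rw [charFun_apply, bMu, integral_finsetSum_measure]
    · refine Finset.sum_congr rfl fun z _ => ?_
      rw [integral_smul_measure, integral_dirac, ENNReal.toReal_ofReal (bW_nonneg h0 h1 m z)]
      simp
    · intro z _
      exact (integrable_dirac (by simp)).smul_measure ENNReal.ofReal_ne_top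
  rw [this]
  have e : ∀ z, ((bW ρ m z : ℝ) : ℂ) * Complex.exp ((inner ℝ (bpt m r s z) w : ℝ) * Complex.I) =
      ∏ i, (((∏ j, nsW ρ (z i j) : ℝ) : ℂ) *
        Complex.exp ((blkY m p q (z i) / Real.sqrt m : ℝ) * Complex.I)) := by
    intro z
    rw [hi, Finset.prod_mul_distrib, ← Complex.exp_sum, ← Finset.sum_mul, bW]
    push_cast
    rfl
  simp_rw [e]
  rw [← Fintype.prod_sum (fun (_ : Fin m) (y : Fin m → Bool × Bool) =>
    (((∏ j, nsW ρ (y j) : ℝ) : ℂ) * Complex.exp ((blkY m p q y / Real.sqrt m : ℝ) * Complex.I)))]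
  simp [blkPhi]

open MeasureTheory Filter Topology in
lemma bMu_tendsto {ρ : ℝ} (h0 : 0 ≤ ρ) (h1 : ρ < 1) (C : Set ℂ) (hC : IsClosed C) (b : ℝ)
    (hb : gC C ≤ ENNReal.ofReal b) (hb0 : 0 ≤ b) (ε : ℝ) (hε : 0 < ε) :
    ∀ᶠ m : ℕ in atTop, bE ρ m (fun z => C.indicator 1
      (bpt m (ρ ^ 2) (Real.sqrt (1 - (ρ ^ 2) ^ 2)) z)) < b + ε := by
  set r := ρ ^ 2 with hr
  set s := Real.sqrt (1 - r ^ 2) with hs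
  have hr1 : r < 1 := by nlinarith
  have hr0 : 0 ≤ r := by positivity
  have hpos : 0 < 1 - r ^ 2 := by nlinarith
  have s0 : 0 < s := Real.sqrt_pos.2 hpos
  have s2 : s ^ 2 = 1 - r ^ 2 := Real.sq_sqrt hpos.le
  let μs : ℕ → ProbabilityMeasure ℂ := fun m => ⟨bMu ρ m r s, bMu_prob h0 h1.le m r s⟩
  let μ : ProbabilityMeasure ℂ := ⟨gC, gC_prob⟩
  have ht : Tendsto μs atTop (𝓝 μ) := by
    apply ProbabilityMeasure.tendsto_of_tendsto_charFun
    intro w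
    show Tendsto (fun m => charFun (bMu ρ m r s) w) atTop (𝓝 (charFun gC w))
    simp_rw [charFun_bMu h0 h1.le _ r s s0.ne' w, charFun_gC]
    convert blkPhi_tendsto h0 h1.le _ _ using 3
    rw [← hr, ← Complex.ofReal_neg, ← Complex.ofReal_neg, show (2 : ℂ) = ((2 : ℝ) : ℂ) by norm_num,
      ← Complex.ofReal_div]
    congr 1
    have q2 : Real.sqrt 2 ^ 2 = 2 := Real.sq_sqrt (by norm_num)
    have q0 : Real.sqrt 2 ≠ 0 := by positivity
    field_simp
    rw [q2]
    linear_combination (- 2 * w.im ^ 2) * s2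
  have hl := ProbabilityMeasure.limsup_measure_closed_le_of_tendsto ht hC
  have hl2 : atTop.limsup (fun m => (μs m : Measure ℂ) C) < ENNReal.ofReal (b + ε) := by
    refine lt_of_le_of_lt (hl.trans hb) ?_
    rw [ENNReal.ofReal_lt_ofReal_iff (by linarith)]
    linarith
  filter_upwards [eventually_lt_of_limsup_lt hl2] with m hm
  have hm' : bMu ρ m r s C < ENNReal.ofReal (b + ε) := hm
  rw [bMu_apply h0 h1.le m r s C hC.measurableSet, ENNReal.ofReal_lt_ofReal_iff (by linarith)] at hm'
  exact hm'

lemma bVar_bounds {t : ℝ} (ht : 0 < t) (m : ℕ) (hm : 0 < m) (ρ r s : ℝ) (hρ : ρ = Real.exp (-2 * t))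
    (hs : 0 < s) :
    ∃ p c : ℝ, p = bE ρ m (fun z => Set.indicator {z : ℂ | 0 ≤ z.re} 1 (bpt m r s z)) ∧
      1 - p ≤ bE ρ m (fun z => Set.indicator {z : ℂ | z.re ≤ 0} 1 (bpt m r s z)) ∧
      c = bE ρ m (fun z => Set.indicator {z : ℂ | 0 ≤ z.re ∧ 0 ≤ -r * z.re + s * z.im} 1
        (bpt m r s z)) ∧
      p - c - p ^ 2 ≤ bVar (m * m) (bP (m * m) t (Set.indicator (Bm m) 1)) ∧
      bVar (m * m) (bP (m * m) t (Set.indicator (Bm m) 1)) ≤ 1 := by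
  have h0 : 0 ≤ ρ := by rw [hρ]; positivity
  have h1 : ρ ≤ 1 := by rw [hρ, Real.exp_le_one_iff]; linarith
  have q0 : 0 < Real.sqrt 2 := by positivity
  refine ⟨_, _, rfl, ?_, rfl, ?_, ?_⟩
  · have := bE_mono h0 h1 (m := m) (F := fun _ => 1) (G := fun z =>
      Set.indicator {z : ℂ | 0 ≤ z.re} 1 (bpt m r s z) +
      Set.indicator {z : ℂ | z.re ≤ 0} 1 (bpt m r s z)) (by
        intro z
        simp only [Set.indicator_apply, Set.mem_ofPred_eq, Pi.one_apply]
        split_ifs <;> first | linarith | norm_num)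
    rw [bE_add, bE_const] at this
    linarith
  all_goals
    rw [bVar_bP, ← hρ, nsE_flat, nsE_flat]
    have hp : (fun z : Fin m → Fin m → Bool × Bool =>
        (Set.indicator (Bm m) 1 (fun i => (flat z i).1) : ℝ)) =
        fun z => Set.indicator {z : ℂ | 0 ≤ z.re} 1 (bpt m r s z) := by
      funext z
      have := mem_Bm m hm Prod.fst z
      have e : 0 ≤ (bpt m r s z).re ↔ bX m Prod.fst z ≤ 0 := by
        simp only [bpt]
        rw [le_div_iff₀ q0]
        simp
      by_cases a : (fun i => (flat z i).1) ∈ Bm m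
      · rw [Set.indicator_of_mem a, Set.indicator_of_mem (show bpt m r s z ∈ {z : ℂ | 0 ≤ z.re} from
          e.2 (this.1 a))]
        rfl
      · rw [Set.indicator_of_notMem a, Set.indicator_of_notMem
          (show bpt m r s z ∉ {z : ℂ | 0 ≤ z.re} from fun h => a (this.2 (e.1 h)))]
    rw [hp]
  · have := bE_mono h0 h1 (m := m)
      (F := fun z => Set.indicator {z : ℂ | 0 ≤ z.re} 1 (bpt m r s z)) (G := fun z =>
      Set.indicator (Bm m) 1 (fun i => (flat z i).1) * Set.indicator (Bm m) 1 (fun i => (flat z i).2)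
      + Set.indicator {z : ℂ | 0 ≤ z.re ∧ 0 ≤ -r * z.re + s * z.im} 1 (bpt m r s z)) (by
        intro z
        have hx := congrFun hp z
        have hy := mem_Bm m hm Prod.snd z
        have e : -r * (bpt m r s z).re + s * (bpt m r s z).im = bX m Prod.snd z / Real.sqrt 2 := by
          simp only [bpt]; field_simp; ring
        have hy1 : bX m Prod.snd z ≤ 0 →
            (Set.indicator (Bm m) 1 (fun i => (flat z i).2) : ℝ) = 1 :=
          fun h => by rw [Set.indicator_of_mem (hy.2 h)]; rfl
        have hy0 : ¬ bX m Prod.snd z ≤ 0 →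
            (Set.indicator (Bm m) 1 (fun i => (flat z i).2) : ℝ) = 0 :=
          fun h => Set.indicator_of_notMem (fun h' => h (hy.1 h')) _
        rw [hx]
        simp only [Set.indicator_apply {z : ℂ | _}, Set.mem_ofPred_eq, Pi.one_apply, e]
        by_cases a : 0 ≤ (bpt m r s z).re
        · by_cases b : bX m Prod.snd z ≤ 0
          · rw [hy1 b]; simp only [a, if_true]; split_ifs <;> norm_num
          · have : 0 ≤ bX m Prod.snd z / Real.sqrt 2 := div_nonneg (le_of_not_ge b) q0.le
            rw [hy0 b]
            simp [a, this]
        · simp [a])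
    rw [bE_add] at this
    linarith
  · have := bE_mono h0 h1 (m := m) (G := fun _ => 1) (F := fun z : Fin m → Fin m → Bool × Bool =>
      Set.indicator (Bm m) 1 (fun i => (flat z i).1) * Set.indicator (Bm m) 1 (fun i => (flat z i).2))
      (by
        intro z
        by_cases a : (fun i => (flat z i).1) ∈ Bm m <;>
          by_cases b : (fun i => (flat z i).2) ∈ Bm m <;> simp [a, b])
    rw [bE_const] at this
    nlinarith [sq_nonneg (bE ρ m (fun z => Set.indicator {z : ℂ | 0 ≤ z.re} 1 (bpt m r s z)))]

theorem stmt11 (t : ℝ) (ht : 0 < t) :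
    Filter.atTop.liminf (fun m : ℕ =>
      bVar (m*m) (bP (m*m) t (Set.indicator (Bm m) 1))) ≥
      1/4 - Real.arccos (Real.exp (-2*t)) / (Real.sqrt 2 * Real.pi) := by
  set ρ := Real.exp (-2 * t) with hρ
  have h0 : 0 < ρ := Real.exp_pos _
  have h1 : ρ < 1 := by rw [hρ, Real.exp_lt_one_iff]; linarith
  have hr0 : 0 < ρ ^ 2 := by positivity
  have hr1 : ρ ^ 2 < 1 := by nlinarith
  have hs : 0 < Real.sqrt (1 - (ρ ^ 2) ^ 2) := Real.sqrt_pos.2 (by nlinarith)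
  have q2 : Real.sqrt 2 * Real.sqrt 2 = 2 := Real.mul_self_sqrt (by norm_num)
  have q0 : 0 < Real.sqrt 2 := by positivity
  have hA : Real.arccos (ρ ^ 2) / (2 * π) ≤ Real.arccos ρ / (Real.sqrt 2 * π) := by
    have := arccos_ineq h0 h1
    rw [div_le_div_iff₀ (by positivity) (by positivity)]
    have h2 := mul_le_mul_of_nonneg_right this (show 0 ≤ Real.sqrt 2 * π by positivity)
    linear_combination h2 + Real.arccos ρ * π * q2
  have hev : ∀ᶠ m : ℕ in Filter.atTop,
      bVar (m*m) (bP (m*m) t (Set.indicator (Bm m) 1)) ≤ 1 := by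
    filter_upwards [Filter.eventually_gt_atTop 0] with m hm
    obtain ⟨p, c, -, -, -, -, h⟩ := bVar_bounds ht m hm ρ (ρ ^ 2) _ hρ hs
    exact h
  rw [ge_iff_le]
  refine le_of_forall_pos_le_add fun δ hδ => ?_
  rw [← sub_le_iff_le_add]
  refine Filter.le_liminf_of_le ?_ ?_
  · exact (Filter.isBoundedUnder_of_eventually_le hev).isCoboundedUnder_ge
  obtain ⟨ε, hε, hε1, hεδ⟩ : ∃ ε : ℝ, 0 < ε ∧ ε ≤ 1 ∧ 2 * ε ≤ δ :=
    ⟨min 1 (δ / 2), by positivity, min_le_left _ _, by linarith [min_le_right 1 (δ / 2)]⟩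
  have c1 : IsClosed {z : ℂ | 0 ≤ z.re} := isClosed_le continuous_const Complex.continuous_re
  have c2 : IsClosed {z : ℂ | z.re ≤ 0} := isClosed_le Complex.continuous_re continuous_const
  have c3 : IsClosed {z : ℂ | 0 ≤ z.re ∧
      0 ≤ -(ρ ^ 2) * z.re + Real.sqrt (1 - (ρ ^ 2) ^ 2) * z.im} :=
    c1.inter (isClosed_le continuous_const
      ((continuous_const.mul Complex.continuous_re).add
        (continuous_const.mul Complex.continuous_im)))
  have e1 := bMu_tendsto h0.le h1 _ c1 _ gC_right (by norm_num) ε hε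
  have e2 := bMu_tendsto h0.le h1 _ c2 _ gC_left (by norm_num) ε hε
  have e3 := bMu_tendsto h0.le h1 _ c3 _ (gC_sector hr0 hr1 rfl)
    (div_nonneg (Real.arccos_nonneg _) (by positivity)) ε hε
  filter_upwards [e1, e2, e3, Filter.eventually_gt_atTop 0] with m f1 f2 f3 hm
  obtain ⟨p, c, hp, hq, hc, hV, -⟩ := bVar_bounds ht m hm ρ (ρ ^ 2) _ hρ hs
  rw [← hp] at f1
  rw [← hc] at f3
  have : (p - 1 / 2) ^ 2 ≤ ε := by nlinarith
  nlinarith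
end
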